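/- arXiv:2107.14562 — 2 statements merged into one kernel-verified Lean document; each statement's English description precedes it below -/
import Mathlib

section
/- (Lemma 3, moment form) For every α ∈ [0,1] and every x₀ ∈ ℝ^d, the α-interpolated time-slice density G^α_{Δt} has, as Δt → 0⁺, the same moments as the α = 0 Gaussian representation up to order Δt: ∫_{ℝ^d} G^α_{Δt}(x) dx = 1 + o(Δt); ∫_{ℝ^d} (x^i − x₀^i) G^α_{Δt}(x) dx = F^i(x₀) Δt + o(Δt) for each i; ∫_{ℝ^d} (x^i − x₀^i)(x^j − x₀^j) G^α_{Δt}(x) dx = 2 D^{ij}(x₀) Δt + o(Δt) for each pair i, j; and ∫_{ℝ^d} (x^{i₁} − x₀^{i₁}) ⋯ (x^{i_M} − x₀^{i_M}) G^α_{Δt}(x) dx = o(Δt) for every M ≥ 3. -/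
open MeasureTheory Real Filter Asymptotics Topology

/-- Partial derivative `∂_k f` of a scalar field on `ℝ^d`, at a point. -/
noncomputable def pd {d : ℕ} (f : (Fin d → ℝ) → ℝ) (k : Fin d) (x : Fin d → ℝ) : ℝ :=
  fderiv ℝ f x (Pi.single k 1)

/-- Second partial derivative `∂_i ∂_j f` of a scalar field on `ℝ^d`, at a point. -/
noncomputable def pd2 {d : ℕ} (f : (Fin d → ℝ) → ℝ) (i j : Fin d) (x : Fin d → ℝ) : ℝ :=
  pd (fun y => pd f j y) i x

/-- The α-interpolated time-slice density `G^α_{Δt}(x)` of Lemma 3 (Eq. (24)):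
all fields are evaluated at `x_α = x₀ + α Δx`, `Δx = x − x₀`, and
`G^α_{Δt}(x) = ((4πΔt)^d det D(x_α))^{-1/2}
  exp{ −(Δx^i − F^i Δt + 2α ∂_k D^{ik} Δt)(D⁻¹_{ij}/(4Δt))(Δx^j − F^j Δt + 2α ∂_l D^{jl} Δt)
       − α ∂_i F^i Δt + α² ∂_i ∂_j D^{ij} Δt }`. -/
noncomputable def Galpha (d : ℕ)
    (D : (Fin d → ℝ) → Matrix (Fin d) (Fin d) ℝ)
    (F : (Fin d → ℝ) → Fin d → ℝ)
    (α : ℝ) (x₀ : Fin d → ℝ) (Δt : ℝ) (x : Fin d → ℝ) : ℝ :=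
  let xa : Fin d → ℝ := fun i => x₀ i + α * (x i - x₀ i)
  let drift : Fin d → ℝ := fun i =>
    (x i - x₀ i) - F xa i * Δt + 2 * α * (∑ k, pd (fun y => D y i k) k xa) * Δt
  (Real.sqrt ((4 * π * Δt) ^ d * (D xa).det))⁻¹ *
    Real.exp (-(∑ i, ∑ j, drift i * ((D xa)⁻¹ i j / (4 * Δt)) * drift j)
      - α * (∑ i, pd (fun y => F y i) i xa) * Δt
      + α ^ 2 * (∑ i, ∑ j, pd2 (fun y => D y i j) i j xa) * Δt)

/-- The centred Gaussian density with covariance matrix `2 A`. -/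
noncomputable def gaussDensity {d : ℕ} (A : Matrix (Fin d) (Fin d) ℝ) (y : Fin d → ℝ) : ℝ :=
  (√((4 * π) ^ d * A.det))⁻¹ * rexp (-(∑ i, ∑ j, y i * A⁻¹ i j * y j) / 4)

open scoped MatrixOrder Matrix.Norms.L2Operator in
lemma exists_eq_transpose_mul_self {d : ℕ} {A : Matrix (Fin d) (Fin d) ℝ} (hA : A.PosDef) :
    ∃ S : Matrix (Fin d) (Fin d) ℝ, A = S.transpose * S := by
  obtain ⟨S, hS⟩ := CStarAlgebra.nonneg_iff_eq_star_mul_self.mp hA.posSemidef.nonneg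
  exact ⟨S, by rw [hS, Matrix.star_eq_conjTranspose, Matrix.conjTranspose_eq_transpose_of_trivial]⟩

lemma integral_pow_mul_gaussianPDFReal (n : ℕ) :
    ∫ t : ℝ, t ^ n * ProbabilityTheory.gaussianPDFReal 0 2 t
      = ∫ t : ℝ, t ^ n ∂ProbabilityTheory.gaussianReal 0 2 := by
  rw [ProbabilityTheory.integral_gaussianReal_eq_integral_smul (by norm_num)]
  simp [mul_comm]

lemma integral_sq_mul_gaussianPDFReal :
    ∫ t : ℝ, t ^ 2 * ProbabilityTheory.gaussianPDFReal 0 2 t = 2 := by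
  rw [integral_pow_mul_gaussianPDFReal]
  have h := ProbabilityTheory.variance_fun_id_gaussianReal (μ := 0) (v := 2)
  rw [ProbabilityTheory.variance_eq_integral (by fun_prop)] at h
  simpa using h

lemma integrable_pow_mul_gaussianPDFReal (n : ℕ) :
    Integrable fun t : ℝ => t ^ n * ProbabilityTheory.gaussianPDFReal 0 2 t := by
  have h := integrable_rpow_mul_exp_neg_mul_sq (b := 1 / 4) (by norm_num) (s := n)
    (by have := Nat.cast_nonneg (α := ℝ) n; linarith)
  refine (h.const_mul (√(2 * π * 2))⁻¹).congr (ae_of_all _ fun t => ?_)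
  simp only [ProbabilityTheory.gaussianPDFReal, rpow_natCast, sub_zero, NNReal.coe_ofNat]
  rw [mul_left_comm, show -(1 / 4) * t ^ 2 = -t ^ 2 / (2 * 2) by ring]

lemma stdGauss_monomial {d : ℕ} (m : Fin d → ℕ) (u : Fin d → ℝ) :
    (∏ i, u i ^ m i) * ∏ i, ProbabilityTheory.gaussianPDFReal 0 2 (u i)
      = ∏ i, (fun i t => t ^ m i * ProbabilityTheory.gaussianPDFReal 0 2 t) i (u i) := by
  simp [Finset.prod_mul_distrib]

lemma mul_eq_prod_pow {d : ℕ} (k l : Fin d) (u : Fin d → ℝ) :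
    u k * u l = ∏ i, u i ^ ((if i = k then 1 else 0) + (if i = l then 1 else 0)) := by
  simp_rw [pow_add, Finset.prod_mul_distrib]
  simp

lemma integrable_mul_stdGauss {d : ℕ} (k l : Fin d) :
    Integrable fun u : Fin d → ℝ =>
      u k * u l * ∏ i, ProbabilityTheory.gaussianPDFReal 0 2 (u i) := by
  simp_rw [mul_eq_prod_pow k l, stdGauss_monomial]
  exact Integrable.fintype_prod fun i => integrable_pow_mul_gaussianPDFReal _

lemma integral_mul_stdGauss {d : ℕ} (k l : Fin d) :
    ∫ u : Fin d → ℝ, u k * u l * ∏ i, ProbabilityTheory.gaussianPDFReal 0 2 (u i)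
      = if k = l then 2 else 0 := by
  simp_rw [mul_eq_prod_pow k l, stdGauss_monomial]
  rw [integral_fintype_prod_volume_eq_prod fun i t =>
    t ^ ((if i = k then 1 else 0) + (if i = l then 1 else 0)) *
      ProbabilityTheory.gaussianPDFReal 0 2 t]
  split_ifs with h
  · subst h
    rw [Finset.prod_eq_single k]
    · simpa using integral_sq_mul_gaussianPDFReal
    · intro i _ hi
      simpa [hi] using ProbabilityTheory.integral_gaussianPDFReal_eq_one 0 (by norm_num)
    · simp
  · refine Finset.prod_eq_zero (Finset.mem_univ k) ?_
    have := integral_pow_mul_gaussianPDFReal 1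
    simpa [h] using this

lemma integral_stdGauss {d : ℕ} :
    ∫ u : Fin d → ℝ, ∏ i, ProbabilityTheory.gaussianPDFReal 0 2 (u i) = 1 := by
  rw [integral_fintype_prod_volume_eq_prod]
  simp [ProbabilityTheory.integral_gaussianPDFReal_eq_one 0 (show (2 : NNReal) ≠ 0 by norm_num)]

lemma integral_mul_gaussDensity {d : ℕ} {S : Matrix (Fin d) (Fin d) ℝ} (hS : S.det ≠ 0)
    {p : (Fin d → ℝ) → ℝ} (hp : Continuous p) :
    ∫ y, p y * gaussDensity (S.transpose * S) y
      = ∫ u, p (S.transpose.mulVec u) * ∏ i, ProbabilityTheory.gaussianPDFReal 0 2 (u i) := by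
  have hmap := Real.map_matrix_volume_pi_eq_smul_volume_pi
    (M := S.transpose) (by rwa [Matrix.det_transpose])
  have hcont : Continuous fun y => p y * gaussDensity (S.transpose * S) y := by
    unfold gaussDensity; fun_prop
  have h1 : ∫ u, p (S.transpose.mulVec u) * gaussDensity (S.transpose * S) (S.transpose.mulVec u)
      = |S.det|⁻¹ * ∫ y, p y * gaussDensity (S.transpose * S) y := by
    have h2 := integral_map (μ := volume) (φ := Matrix.toLin' S.transpose)
      (by fun_prop) (f := fun y => p y * gaussDensity (S.transpose * S) y)
      hcont.aestronglyMeasurable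
    rw [hmap, integral_smul_measure, Matrix.det_transpose,
      ENNReal.toReal_ofReal (abs_nonneg _), abs_inv] at h2
    simpa using h2.symm
  have h3 : ∀ u, gaussDensity (S.transpose * S) (S.transpose.mulVec u)
      = |S.det|⁻¹ * ∏ i, ProbabilityTheory.gaussianPDFReal 0 2 (u i) := by
    intro u
    have hq : ∑ i, ∑ j, S.transpose.mulVec u i * (S.transpose * S)⁻¹ i j * S.transpose.mulVec u j
        = ∑ i, u i ^ 2 := by
      have : ∑ i, ∑ j, S.transpose.mulVec u i * (S.transpose * S)⁻¹ i j * S.transpose.mulVec u j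
          = S.transpose.mulVec u ⬝ᵥ (S.transpose * S)⁻¹.mulVec (S.transpose.mulVec u) := by
        simp [dotProduct, Matrix.mulVec, Finset.mul_sum, mul_assoc]
      have hu : IsUnit S.det := isUnit_iff_ne_zero.2 hS
      have hu' : IsUnit S.transpose.det := by rwa [Matrix.det_transpose]
      rw [this, Matrix.mul_inv_rev, Matrix.mulVec_mulVec, Matrix.mul_assoc,
        Matrix.nonsing_inv_mul _ hu', Matrix.mul_one, Matrix.mulVec_transpose,
        ← Matrix.dotProduct_mulVec, Matrix.mulVec_mulVec, Matrix.mul_nonsing_inv _ hu,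
        Matrix.one_mulVec]
      simp [dotProduct, sq]
    unfold gaussDensity ProbabilityTheory.gaussianPDFReal
    have hexp : rexp (-(∑ i, u i ^ 2) / 4) = ∏ i, rexp (-(u i) ^ 2 / (2 * 2)) := by
      rw [← Real.exp_sum, ← Finset.sum_neg_distrib, Finset.sum_div]
      norm_num
    have hsqrt : √((4 * π) ^ d * (S.det * S.det)) = √(2 * π * 2) ^ d * |S.det| := by
      rw [Real.sqrt_mul (by positivity), Real.sqrt_mul_self_eq_abs]
      congr 1
      rw [Real.sqrt_eq_iff_mul_self_eq (by positivity) (by positivity), ← mul_pow,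
        Real.mul_self_sqrt (by positivity)]
      ring
    rw [hq, Finset.prod_mul_distrib, Matrix.det_mul, Matrix.det_transpose, hsqrt, hexp]
    simp only [sub_zero, NNReal.coe_ofNat, Finset.prod_const, Finset.card_univ, Fintype.card_fin,
      inv_pow, mul_inv]
    ring
  simp_rw [h3, mul_left_comm _ |S.det|⁻¹, integral_const_mul] at h1
  exact (mul_left_cancel₀ (inv_ne_zero (abs_ne_zero.2 hS)) h1).symm

lemma Matrix.PosDef.exists_sqrt {d : ℕ} {A : Matrix (Fin d) (Fin d) ℝ} (hA : A.PosDef) :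
    ∃ S : Matrix (Fin d) (Fin d) ℝ, S.det ≠ 0 ∧ A = S.transpose * S := by
  obtain ⟨S, rfl⟩ := exists_eq_transpose_mul_self hA
  refine ⟨S, fun h => hA.det_pos.ne' ?_, rfl⟩
  simp [h]

lemma integral_gaussDensity {d : ℕ} {A : Matrix (Fin d) (Fin d) ℝ} (hA : A.PosDef) :
    ∫ y, gaussDensity A y = 1 := by
  obtain ⟨S, hS, rfl⟩ := hA.exists_sqrt
  simpa [integral_stdGauss] using integral_mul_gaussDensity hS (p := fun _ => 1) (by fun_prop)

lemma integral_coord_mul_gaussDensity {d : ℕ} (A : Matrix (Fin d) (Fin d) ℝ) (i : Fin d) :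
    ∫ y, y i * gaussDensity A y = 0 := by
  have h := integral_neg_eq_self (fun y : Fin d → ℝ => y i * gaussDensity A y) volume
  have h2 : ∀ y : Fin d → ℝ, gaussDensity A (-y) = gaussDensity A y := by
    intro y; simp [gaussDensity]
  simp only [h2, Pi.neg_apply, neg_mul, integral_neg] at h
  linarith

lemma integral_coord_mul_coord_mul_gaussDensity {d : ℕ} {A : Matrix (Fin d) (Fin d) ℝ}
    (hA : A.PosDef) (i j : Fin d) :
    ∫ y, y i * y j * gaussDensity A y = 2 * A i j := by
  obtain ⟨S, hS, rfl⟩ := hA.exists_sqrt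
  rw [integral_mul_gaussDensity hS (p := fun y => y i * y j) (by fun_prop)]
  have : ∀ u : Fin d → ℝ, S.transpose.mulVec u i * S.transpose.mulVec u j *
      ∏ i, ProbabilityTheory.gaussianPDFReal 0 2 (u i) = ∑ k, ∑ l, S k i * S l j *
        (u k * u l * ∏ i, ProbabilityTheory.gaussianPDFReal 0 2 (u i)) := by
    intro u
    simp only [Matrix.mulVec, dotProduct, Matrix.transpose_apply]
    rw [Finset.sum_mul_sum]
    simp only [Finset.sum_mul]
    exact Finset.sum_congr rfl fun k _ => Finset.sum_congr rfl fun l _ => by ring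
  simp_rw [this]
  rw [integral_finsetSum _ fun k _ => integrable_finsetSum _ fun l _ =>
    (integrable_mul_stdGauss k l).const_mul _]
  simp_rw [integral_finsetSum _ fun l _ => (integrable_mul_stdGauss _ l).const_mul _,
    integral_const_mul, integral_mul_stdGauss]
  simp [Matrix.mul_apply, Finset.mul_sum, mul_comm]

lemma ContDiff.isLittleO_taylor_two {E : Type*} [NormedAddCommGroup E] [NormedSpace ℝ E]
    {f : E → ℝ} (hf : ContDiff ℝ 2 f) (x : E) :
    (fun w => f (x + w) - f x - fderiv ℝ f x w - fderiv ℝ (fderiv ℝ f) x w w / 2)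
      =o[𝓝 0] fun w => ‖w‖ ^ 2 := by
  have hsymm : IsSymmSndFDerivAt ℝ f x :=
    hf.contDiffAt.isSymmSndFDerivAt (by simp)
  have hf' : Differentiable ℝ (fderiv ℝ f) :=
    (hf.fderiv_right (m := 1) (by norm_num)).differentiable (by norm_num)
  set Q := fderiv ℝ (fderiv ℝ f) x with hQ
  have hd : ∀ w, HasFDerivAt
      (fun w => f (x + w) - f x - fderiv ℝ f x w - Q w w / 2)
      (fderiv ℝ f (x + w) - fderiv ℝ f x - Q w) w := by
    intro w
    have h1 : HasFDerivAt (fun w => f (x + w)) (fderiv ℝ f (x + w)) w :=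
      (hasFDerivAt_comp_add_left x).2 (hf.differentiable (by norm_num) (x + w)).hasFDerivAt
    have h2 : HasFDerivAt (fun w => Q w w) (Q w + Q.flip w) w := by
      refine (Q.hasFDerivAt.clm_apply (hasFDerivAt_id w)).congr_fderiv ?_
      ext v
      simp
    have h3 := ((h1.sub_const (f x)).sub (fderiv ℝ f x).hasFDerivAt).sub (h2.mul_const (1 / 2))
    have hfun : (fun w => f (x + w) - f x - fderiv ℝ f x w - Q w w / 2)
        = ((fun w => f (x + w) - f x) - fun w => fderiv ℝ f x w) - fun w => Q w w * (1 / 2) := by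
      ext v; simp only [Pi.sub_apply]; ring
    rw [hfun]
    refine h3.congr_fderiv ?_
    ext v
    have : Q v w = Q w v := hsymm v w
    simp [this]
    ring
  have ho : (fun w => fderiv ℝ f (x + w) - fderiv ℝ f x - Q w) =o[𝓝 0] fun w => w := by
    simpa [hasFDerivAt_iff_isLittleO_nhds_zero] using (hf' x).hasFDerivAt
  have := Convex.isLittleO_pow_succ (s := Set.univ) (x₀ := (0 : E)) (n := 1)
    (f := fun w => f (x + w) - f x - fderiv ℝ f x w - Q w w / 2)
    (f' := fun w => fderiv ℝ f (x + w) - fderiv ℝ f x - Q w)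
    convex_univ (Set.mem_univ _) (fun w _ => (hd w).hasFDerivWithinAt)
    (by simpa using ho.norm_right)
  simpa using this

lemma exists_bound_sub {E : Type*} [NormedAddCommGroup E] [NormedSpace ℝ E]
    {f : E → ℝ} {x : E} (hf : DifferentiableAt ℝ f x) {K : ℝ} (hK : ∀ z, |f z| ≤ K) :
    ∃ M, 0 ≤ M ∧ ∀ w, |f (x + w) - f x| ≤ M * ‖w‖ := by
  have h : (fun w => f (x + w) - f x) =O[𝓝 0] fun w => w := by
    have h1 := (hasFDerivAt_iff_isLittleO_nhds_zero.1 hf.hasFDerivAt).isBigO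
    simpa using h1.add ((fderiv ℝ f x).isBigO_id (𝓝 0))
  obtain ⟨c, hc, h⟩ := h.exists_nonneg
  obtain ⟨δ, hδ, hb⟩ := Metric.eventually_nhds_iff.1 h.bound
  have hK0 : 0 ≤ K := (abs_nonneg _).trans (hK x)
  refine ⟨c + 2 * K / δ, by positivity, fun w => ?_⟩
  rcases lt_or_ge ‖w‖ δ with hw | hw
  · have := hb (y := w) (by simpa using hw)
    rw [Real.norm_eq_abs] at this
    have h2 : 0 ≤ 2 * K / δ * ‖w‖ := by positivity
    linarith
  · have h1 : |f (x + w) - f x| ≤ 2 * K := by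
      have := abs_sub (f (x + w)) (f x); linarith [hK (x + w), hK x]
    have h2 : 2 * K ≤ 2 * K / δ * ‖w‖ := by
      rw [div_mul_eq_mul_div, le_div_iff₀ hδ]; gcongr
    have h3 : 0 ≤ c * ‖w‖ := by positivity
    linarith

lemma exists_bound_sub_sub_fderiv {E : Type*} [NormedAddCommGroup E] [NormedSpace ℝ E]
    {f : E → ℝ} (hf : ContDiff ℝ 2 f) (x : E) {K : ℝ} (hK : ∀ z, |f z| ≤ K) :
    ∃ M, 0 ≤ M ∧ ∀ w, |f (x + w) - f x - fderiv ℝ f x w| ≤ M * ‖w‖ ^ 2 := by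
  have h : (fun w => f (x + w) - f x - fderiv ℝ f x w) =O[𝓝 0] fun w => ‖w‖ ^ 2 := by
    have h2 : (fun w => fderiv ℝ (fderiv ℝ f) x w w / 2) =O[𝓝 0] fun w => ‖w‖ ^ 2 := by
      refine IsBigO.of_bound (‖fderiv ℝ (fderiv ℝ f) x‖) (Eventually.of_forall fun w => ?_)
      have := (fderiv ℝ (fderiv ℝ f) x).le_opNorm₂ w w
      have h0 := norm_nonneg (fderiv ℝ (fderiv ℝ f) x w w)
      rw [norm_div, norm_pow, norm_norm, sq, ← mul_assoc, Real.norm_ofNat]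
      linarith
    simpa using (hf.isLittleO_taylor_two x).isBigO.add h2
  obtain ⟨c, hc, h⟩ := h.exists_nonneg
  obtain ⟨δ, hδ, hb⟩ := Metric.eventually_nhds_iff.1 h.bound
  have hK0 : 0 ≤ K := (abs_nonneg _).trans (hK x)
  set L := ‖fderiv ℝ f x‖
  refine ⟨c + 2 * K / δ ^ 2 + L / δ, by positivity, fun w => ?_⟩
  rcases lt_or_ge ‖w‖ δ with hw | hw
  · have := hb (y := w) (by simpa using hw)
    rw [Real.norm_eq_abs, norm_pow, norm_norm] at this
    have h2 : 0 ≤ 2 * K / δ ^ 2 * ‖w‖ ^ 2 + L / δ * ‖w‖ ^ 2 := by positivity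
    linarith
  · have h1 : |f (x + w) - f x - fderiv ℝ f x w| ≤ 2 * K + L * ‖w‖ := by
      have h1 := abs_sub (f (x + w) - f x) (fderiv ℝ f x w)
      have h2 := abs_sub (f (x + w)) (f x)
      have h3 := (fderiv ℝ f x).le_opNorm w
      rw [Real.norm_eq_abs] at h3
      linarith [hK (x + w), hK x]
    have h2 : 2 * K ≤ 2 * K / δ ^ 2 * ‖w‖ ^ 2 := by
      rw [div_mul_eq_mul_div, le_div_iff₀ (by positivity)]; gcongr
    have h4 : L * ‖w‖ ≤ L / δ * ‖w‖ ^ 2 := by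
      rw [div_mul_eq_mul_div, le_div_iff₀ hδ, sq, mul_assoc]; gcongr
    have h3 : 0 ≤ c * ‖w‖ ^ 2 := by positivity
    linarith

lemma isLittleO_integral_of_dominated {Y : Type*} [MeasurableSpace Y] {μ : Measure Y} {k : ℕ}
    {r : ℝ → Y → ℝ} {g : Y → ℝ}
    (hr : ∀ s, AEStronglyMeasurable (r s) μ) (hg : Integrable g μ)
    (hb : ∀ s y, |r s y| ≤ |s| ^ k * g y)
    (ho : ∀ y, (fun s => r s y) =o[𝓝 0] fun s => s ^ k) :
    (fun s => ∫ y, r s y ∂μ) =o[𝓝 0] fun s : ℝ => s ^ k := by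
  have hz : ∀ s y, s ^ k = 0 → r s y = 0 := by
    intro s y hs
    have := hb s y
    rw [← abs_pow, hs] at this
    simpa using this
  rw [isLittleO_iff_tendsto fun s hs => by simp [hz s _ hs]]
  have hg0 : ∀ y, 0 ≤ g y := fun y => by simpa using (abs_nonneg _).trans (hb 1 y)
  simp_rw [← integral_div]
  have h0 : ∫ _, (0 : ℝ) ∂μ = 0 := integral_zero Y ℝ
  nth_rw 2 [← h0]
  refine tendsto_integral_filter_of_dominated_convergence g
    (Eventually.of_forall fun s => ?_) (Eventually.of_forall fun s => ae_of_all _ fun y => ?_) hg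
    (ae_of_all _ fun y => ?_)
  · simpa only [div_eq_mul_inv] using (hr s).mul_const _
  · rw [Real.norm_eq_abs, abs_div, abs_pow]
    exact div_le_of_le_mul₀ (by positivity) (hg0 y) (by rw [mul_comm]; exact hb s y)
  · exact (isLittleO_iff_tendsto fun s hs => hz s y hs).1 (ho y)

lemma integrable_mul_of_dominated {d n : ℕ} {f : (Fin d → ℝ) → (Fin d → ℝ) → ℝ}
    {g : (Fin d → ℝ) → ℝ}
    (hf : Continuous fun p : (Fin d → ℝ) × (Fin d → ℝ) => f p.1 p.2)
    (hfg : ∀ z y, |f z y| ≤ g y) (hg : ∀ n : ℕ, Integrable fun y => (1 + ‖y‖) ^ n * g y)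
    {p : (Fin d → ℝ) → ℝ} (hp : Continuous p) (hpn : ∀ y, |p y| ≤ (1 + ‖y‖) ^ n)
    {u : (Fin d → ℝ) → Fin d → ℝ} (hu : Continuous u) :
    Integrable fun y => p y * f (u y) y := by
  have hc : Continuous fun y => f (u y) y := hf.comp (hu.prodMk continuous_id)
  refine (hg n).mono' (hp.mul hc).aestronglyMeasurable (ae_of_all _ fun y => ?_)
  rw [Real.norm_eq_abs, abs_mul]
  exact mul_le_mul (hpn y) (hfg _ y) (abs_nonneg _) (by positivity)

lemma abs_apply_le_one_add_norm {d : ℕ} (y : Fin d → ℝ) (j : Fin d) : |y j| ≤ 1 + ‖y‖ := by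
  have := norm_le_pi_norm y j
  rw [Real.norm_eq_abs] at this
  linarith

lemma isLittleO_integral_shift_one {d : ℕ} {f : (Fin d → ℝ) → (Fin d → ℝ) → ℝ} {x₀ : Fin d → ℝ}
    {g : (Fin d → ℝ) → ℝ}
    (hf : Continuous fun p : (Fin d → ℝ) × (Fin d → ℝ) => f p.1 p.2)
    (hd : ∀ y, DifferentiableAt ℝ (fun z => f z y) x₀)
    (hfg : ∀ z y, |f z y| ≤ g y)
    (hb : ∀ w y, |f (x₀ + w) y - f x₀ y| ≤ ‖w‖ * g y)
    (hg : ∀ n : ℕ, Integrable fun y => (1 + ‖y‖) ^ n * g y) :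
    (fun s : ℝ => (∫ y, f (x₀ + s • y) y) - (∫ y, f x₀ y)
      - ∑ j, ((∫ y, y j * f (x₀ + s • Pi.single j 1) y) - ∫ y, y j * f x₀ y))
      =o[𝓝 0] fun s => s := by
  have hi0 : ∀ {u : (Fin d → ℝ) → Fin d → ℝ}, Continuous u → Integrable fun y => f (u y) y := by
    intro u hu
    simpa using integrable_mul_of_dominated (n := 0) hf hfg hg (p := fun _ => 1)
      continuous_const (by simp) hu
  have hi1 : ∀ (j) (z : Fin d → ℝ), Integrable fun y => y j * f z y := fun j z =>
    integrable_mul_of_dominated (n := 1) hf hfg hg (p := fun y => y j) (by fun_prop)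
      (fun y => by simpa using abs_apply_le_one_add_norm y j) (u := fun _ => z) continuous_const
  have hint : ∀ s : ℝ, (∫ y, f (x₀ + s • y) y) - (∫ y, f x₀ y)
      - ∑ j, ((∫ y, y j * f (x₀ + s • Pi.single j 1) y) - ∫ y, y j * f x₀ y)
      = ∫ y, (f (x₀ + s • y) y - f x₀ y
        - ∑ j, (y j * f (x₀ + s • Pi.single j 1) y - y j * f x₀ y)) := by
    intro s
    have e1 : Integrable fun y => f (x₀ + s • y) y := hi0 (by fun_prop)
    have e2 : Integrable fun y => f x₀ y := hi0 (u := fun _ => x₀) (by fun_prop)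
    have e3 : ∀ j, Integrable fun y =>
        y j * f (x₀ + s • Pi.single j 1) y - y j * f x₀ y := fun j => (hi1 j _).sub (hi1 j _)
    have e4 : Integrable fun y => f (x₀ + s • y) y - f x₀ y := e1.sub e2
    rw [integral_sub e4 (integrable_finsetSum _ fun j _ => e3 j), integral_sub e1 e2,
      integral_finsetSum _ fun j _ => e3 j]
    simp_rw [integral_sub (hi1 _ _) (hi1 _ _)]
  simp_rw [hint]
  have key := isLittleO_integral_of_dominated (μ := (volume : Measure (Fin d → ℝ))) (k := 1)
    (r := fun s y => f (x₀ + s • y) y - f x₀ y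
        - ∑ j, (y j * f (x₀ + s • Pi.single j 1) y - y j * f x₀ y))
    (g := fun y => (1 + d) * ((1 + ‖y‖) ^ 1 * g y)) ?_ ((hg 1).const_mul _) ?_ ?_
  · simpa using key
  · intro s
    have h1 : ∀ {u : (Fin d → ℝ) → Fin d → ℝ}, Continuous u → Continuous fun y => f (u y) y :=
      fun hu => hf.comp (hu.prodMk continuous_id)
    refine Continuous.aestronglyMeasurable ?_
    refine ((h1 (by fun_prop)).sub (h1 (u := fun _ => x₀) continuous_const)).sub
      (continuous_finsetSum _ fun j _ => ?_)
    exact ((continuous_apply j).mul (h1 (u := fun _ => _) continuous_const)).sub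
      ((continuous_apply j).mul (h1 (u := fun _ => _) continuous_const))
  · intro s y
    have hg0 : 0 ≤ g y := (abs_nonneg _).trans (hfg x₀ y)
    have h1 : |f (x₀ + s • y) y - f x₀ y| ≤ |s| * ((1 + ‖y‖) * g y) := by
      refine (hb _ _).trans ?_
      rw [norm_smul, Real.norm_eq_abs, mul_assoc]
      gcongr
      linarith
    have h2 : ∀ j, |y j * f (x₀ + s • Pi.single j 1) y - y j * f x₀ y|
        ≤ |s| * ((1 + ‖y‖) * g y) := by
      intro j
      rw [← mul_sub, abs_mul]
      refine (mul_le_mul (abs_apply_le_one_add_norm y j) (hb _ _) (abs_nonneg _)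
        (by positivity)).trans_eq ?_
      rw [norm_smul, Pi.norm_single, norm_one, Real.norm_eq_abs]
      ring
    refine (abs_sub _ _).trans ?_
    refine (add_le_add h1 ((Finset.abs_sum_le_sum_abs _ _).trans
      (Finset.sum_le_sum fun j _ => h2 j))).trans_eq ?_
    simp
    ring
  · intro y
    have hdir : ∀ v, (fun s : ℝ => f (x₀ + s • v) y - f x₀ y
        - s * fderiv ℝ (fun z => f z y) x₀ v) =o[𝓝 0] fun s => s := by
      intro v
      have h := (hasFDerivAt_iff_isLittleO_nhds_zero.1 (hd y).hasFDerivAt)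
      have ht : Tendsto (fun s : ℝ => s • v) (𝓝 0) (𝓝 0) := by
        have : Continuous fun s : ℝ => s • v := by fun_prop
        simpa using this.tendsto 0
      have hv : ((fun h : Fin d → ℝ => h) ∘ fun s : ℝ => s • v) =O[𝓝 0] fun s : ℝ => s := by
        exact IsBigO.of_bound ‖v‖ (Eventually.of_forall fun s => by
          simp [norm_smul, mul_comm])
      refine ((h.comp_tendsto ht).trans_isBigO hv).congr_left fun s => ?_
      simp
    have hsum := (hdir y).sub (IsLittleO.fun_sum (s := Finset.univ) fun j _ =>
      (hdir (Pi.single j 1)).const_mul_left (y j))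
    refine (hsum.congr_left fun s => ?_).congr_right fun s => (pow_one s).symm
    have hy : fderiv ℝ (fun z => f z y) x₀ y
        = ∑ j, y j * fderiv ℝ (fun z => f z y) x₀ (Pi.single j 1) := by
      conv_lhs => arg 2; rw [pi_eq_sum_univ' y]
      simp
    have : ∑ j, (y j * f (x₀ + s • Pi.single j 1) y - y j * f x₀ y)
        = s * (∑ j, y j * fderiv ℝ (fun z => f z y) x₀ (Pi.single j 1))
          + ∑ j, y j * (f (x₀ + s • Pi.single j 1) y - f x₀ y
            - s * fderiv ℝ (fun z => f z y) x₀ (Pi.single j 1)) := by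
      rw [Finset.mul_sum, ← Finset.sum_add_distrib]
      exact Finset.sum_congr rfl fun j _ => by ring
    rw [hy, this]
    ring

lemma ContDiff.isLittleO_taylor_two_dir {E : Type*} [NormedAddCommGroup E] [NormedSpace ℝ E]
    {f : E → ℝ} (hf : ContDiff ℝ 2 f) (x v : E) :
    (fun s : ℝ => f (x + s • v) - f x - s * fderiv ℝ f x v
      - s ^ 2 * (fderiv ℝ (fderiv ℝ f) x v v / 2)) =o[𝓝 0] fun s => s ^ 2 := by
  have ht : Tendsto (fun s : ℝ => s • v) (𝓝 0) (𝓝 0) := by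
    have : Continuous fun s : ℝ => s • v := by fun_prop
    simpa using this.tendsto 0
  have hv : ((fun w : E => ‖w‖ ^ 2) ∘ fun s : ℝ => s • v) =O[𝓝 0] fun s : ℝ => s ^ 2 := by
    exact IsBigO.of_bound (‖v‖ ^ 2) (Eventually.of_forall fun s => by
      simp [norm_smul, mul_pow, mul_comm])
  refine (((hf.isLittleO_taylor_two x).comp_tendsto ht).trans_isBigO hv).congr_left fun s => ?_
  simp
  ring

lemma ContDiff.isLittleO_second_difference {E : Type*} [NormedAddCommGroup E] [NormedSpace ℝ E]
    {f : E → ℝ} (hf : ContDiff ℝ 2 f) (x u v : E) :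
    (fun s : ℝ => f (x + s • (u + v)) - f (x + s • u) - f (x + s • v) + f x
      - s ^ 2 * fderiv ℝ (fderiv ℝ f) x u v) =o[𝓝 0] fun s => s ^ 2 := by
  have hsymm : fderiv ℝ (fderiv ℝ f) x v u = fderiv ℝ (fderiv ℝ f) x u v :=
    hf.contDiffAt.isSymmSndFDerivAt (by simp) v u
  refine (((hf.isLittleO_taylor_two_dir x (u + v)).sub (hf.isLittleO_taylor_two_dir x u)).sub
    (hf.isLittleO_taylor_two_dir x v)).congr_left fun s => ?_
  simp only [map_add, add_apply, hsymm]
  ring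

lemma isLittleO_integral_shift_two {d : ℕ} {f : (Fin d → ℝ) → (Fin d → ℝ) → ℝ} {x₀ : Fin d → ℝ}
    {g : (Fin d → ℝ) → ℝ} {m : (Fin d → ℝ) → Fin d → Fin d → ℝ}
    (hf : Continuous fun p : (Fin d → ℝ) × (Fin d → ℝ) => f p.1 p.2)
    (hd : ∀ y, ContDiff ℝ 2 fun z => f z y)
    (hfg : ∀ z y, |f z y| ≤ g y)
    (hb : ∀ w y, |f (x₀ + w) y - f x₀ y - fderiv ℝ (fun z => f z y) x₀ w| ≤ ‖w‖ ^ 2 * g y)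
    (hg : ∀ n : ℕ, Integrable fun y => (1 + ‖y‖) ^ n * g y)
    (h1 : ∀ z j, ∫ y, y j * f z y = 0) (h2 : ∀ z j k, ∫ y, y j * y k * f z y = m z j k) :
    (fun s : ℝ => (∫ y, f (x₀ + s • y) y) - (∫ y, f x₀ y)
      - (∑ j, ∑ k, (m (x₀ + s • (Pi.single j 1 + Pi.single k 1)) j k
        - m (x₀ + s • Pi.single j 1) j k - m (x₀ + s • Pi.single k 1) j k + m x₀ j k)) / 2)
      =o[𝓝 0] fun s => s ^ 2 := by
  set e : Fin d → Fin d → ℝ := fun j => Pi.single j 1 with he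
  have henorm : ∀ j, ‖e j‖ = 1 := fun j => by
    show ‖(Pi.single j 1 : Fin d → ℝ)‖ = 1
    rw [Pi.norm_single, norm_one]
  have hi0 : ∀ {u : (Fin d → ℝ) → Fin d → ℝ}, Continuous u → Integrable fun y => f (u y) y := by
    intro u hu
    simpa using integrable_mul_of_dominated (n := 0) hf hfg hg (p := fun _ => 1)
      continuous_const (by simp) hu
  have hi1 : ∀ (j) (z : Fin d → ℝ), Integrable fun y => y j * f z y := fun j z =>
    integrable_mul_of_dominated (n := 1) hf hfg hg (p := fun y => y j) (by fun_prop)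
      (fun y => by simpa using abs_apply_le_one_add_norm y j) (u := fun _ => z) continuous_const
  have habs2 : ∀ (j k) (y : Fin d → ℝ), |y j * y k| ≤ (1 + ‖y‖) ^ 2 := fun j k y => by
    rw [abs_mul, sq]
    exact mul_le_mul (abs_apply_le_one_add_norm y j) (abs_apply_le_one_add_norm y k)
      (abs_nonneg _) (by positivity)
  have hi2 : ∀ (j k) (z : Fin d → ℝ), Integrable fun y => y j * y k * f z y := fun j k z =>
    integrable_mul_of_dominated (n := 2) hf hfg hg (p := fun y => y j * y k) (by fun_prop)
      (habs2 j k) (u := fun _ => z) continuous_const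
  set r₁ : ℝ → Fin d → (Fin d → ℝ) → ℝ := fun s j y =>
    (y j * f (x₀ + s • e j) y - y j * f (x₀ + s • -e j) y) / 2 with hr₁
  set r₂ : ℝ → Fin d → Fin d → (Fin d → ℝ) → ℝ := fun s j k y =>
    (y j * y k * f (x₀ + s • (e j + e k)) y - y j * y k * f (x₀ + s • e j) y
      - y j * y k * f (x₀ + s • e k) y + y j * y k * f x₀ y) / 2 with hr₂
  have hr₁i : ∀ s j, Integrable (r₁ s j) := fun s j => ((hi1 _ _).sub (hi1 _ _)).div_const _
  have hr₂i : ∀ s j k, Integrable (r₂ s j k) := fun s j k =>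
    ((((hi2 _ _ _).sub (hi2 _ _ _)).sub (hi2 _ _ _)).add (hi2 _ _ _)).div_const _
  have hr₁v : ∀ s j, ∫ y, r₁ s j y = 0 := fun s j => by
    simp only [hr₁]
    rw [integral_div, integral_sub (hi1 _ _) (hi1 _ _), h1, h1]
    simp
  have hr₂v : ∀ s j k, ∫ y, r₂ s j k y = (m (x₀ + s • (e j + e k)) j k
        - m (x₀ + s • e j) j k - m (x₀ + s • e k) j k + m x₀ j k) / 2 := fun s j k => by
    have a1 : Integrable fun y => y j * y k * f (x₀ + s • (e j + e k)) y
      - y j * y k * f (x₀ + s • e j) y := (hi2 _ _ _).sub (hi2 _ _ _)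
    have a2 : Integrable fun y => y j * y k * f (x₀ + s • (e j + e k)) y
      - y j * y k * f (x₀ + s • e j) y - y j * y k * f (x₀ + s • e k) y := a1.sub (hi2 _ _ _)
    simp only [hr₂]
    rw [integral_div, integral_add a2 (hi2 _ _ _), integral_sub a1 (hi2 _ _ _),
      integral_sub (hi2 _ _ _) (hi2 _ _ _)]
    simp only [h2]
  set r : ℝ → (Fin d → ℝ) → ℝ := fun s y => f (x₀ + s • y) y - f x₀ y - ∑ j, r₁ s j y
    - ∑ j, ∑ k, r₂ s j k y with hr
  have hri : ∀ s, Integrable (r s) ∧ ∫ y, r s y = (∫ y, f (x₀ + s • y) y) - (∫ y, f x₀ y)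
      - (∑ j, ∑ k, (m (x₀ + s • (e j + e k)) j k
        - m (x₀ + s • e j) j k - m (x₀ + s • e k) j k + m x₀ j k)) / 2 := by
    intro s
    have b1 : Integrable fun y => f (x₀ + s • y) y := hi0 (by fun_prop)
    have b2 : Integrable fun y => f x₀ y := hi0 (u := fun _ => x₀) (by fun_prop)
    have b3 : Integrable fun y => f (x₀ + s • y) y - f x₀ y := b1.sub b2
    have b4 : Integrable fun y => ∑ j, r₁ s j y := integrable_finsetSum _ fun j _ => hr₁i s j
    have b5 : ∀ j, Integrable fun y => ∑ k, r₂ s j k y := fun j =>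
      integrable_finsetSum _ fun k _ => hr₂i s j k
    have b6 : Integrable fun y => ∑ j, ∑ k, r₂ s j k y := integrable_finsetSum _ fun j _ => b5 j
    have b7 : Integrable fun y => f (x₀ + s • y) y - f x₀ y - ∑ j, r₁ s j y := b3.sub b4
    refine ⟨b7.sub b6, ?_⟩
    simp only [hr]
    rw [integral_sub b7 b6, integral_sub b3 b4, integral_sub b1 b2,
      integral_finsetSum _ fun j _ => hr₁i s j, integral_finsetSum _ fun j _ => b5 j]
    simp_rw [integral_finsetSum _ fun k _ => hr₂i s _ k, hr₁v, hr₂v, ← Finset.sum_div]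
    simp
  refine IsLittleO.congr_left ?_ fun s => (hri s).2
  set L : (Fin d → ℝ) → (Fin d → ℝ) →L[ℝ] ℝ := fun y => fderiv ℝ (fun z => f z y) x₀ with hL
  set R : ℝ → (Fin d → ℝ) → (Fin d → ℝ) → ℝ := fun s v y =>
    f (x₀ + s • v) y - f x₀ y - s * L y v with hR
  have hrR : ∀ s y, r s y = R s y y - ∑ j, y j * (R s (e j) y - R s (-e j) y) / 2
      - ∑ j, ∑ k, y j * y k * (R s (e j + e k) y - R s (e j) y - R s (e k) y) / 2 := by
    intro s y
    have hLy : L y y = ∑ j, y j * L y (e j) := by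
      conv_lhs => arg 2; rw [pi_eq_sum_univ' y]
      simp [he]
    have c1 : ∑ j, y j * (R s (e j) y - R s (-e j) y) / 2 = ∑ j, r₁ s j y - s * L y y := by
      rw [hLy, Finset.mul_sum, ← Finset.sum_sub_distrib]
      refine Finset.sum_congr rfl fun j _ => ?_
      simp only [hR, hr₁, map_neg]
      ring
    have c2 : ∀ j k, y j * y k * (R s (e j + e k) y - R s (e j) y - R s (e k) y) / 2
        = r₂ s j k y := by
      intro j k
      simp only [hR, hr₂, map_add]
      ring
    simp_rw [c1, c2]
    simp only [hr, hR]
    ring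
  have hRb : ∀ s v y, |R s v y| ≤ |s| ^ 2 * (‖v‖ ^ 2 * g y) := by
    intro s v y
    have := hb (s • v) y
    rw [norm_smul, Real.norm_eq_abs, mul_pow, mul_assoc, map_smul, smul_eq_mul] at this
    exact this
  refine isLittleO_integral_of_dominated (g := fun y => (1 + d + 3 * d ^ 2) * ((1 + ‖y‖) ^ 2 * g y))
    (fun s => (hri s).1.aestronglyMeasurable) ((hg 2).const_mul _) ?_ ?_
  · intro s y
    have hg0 : 0 ≤ g y := (abs_nonneg _).trans (hfg x₀ y)
    set G := |s| ^ 2 * ((1 + ‖y‖) ^ 2 * g y) with hG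
    have hG' : |s| ^ 2 * g y * (1 + ‖y‖) ^ 2 = G := by rw [hG]; ring
    have d0 : |R s y y| ≤ G := (hRb s y y).trans (by rw [hG]; gcongr; linarith)
    have hle : |s| ^ 2 * g y * (1 + ‖y‖) ≤ G := by
      rw [← hG']
      have : (1 + ‖y‖) ≤ (1 + ‖y‖) ^ 2 := by nlinarith [norm_nonneg y]
      gcongr
    have d1 : ∀ j, |y j * (R s (e j) y - R s (-e j) y) / 2| ≤ G := by
      intro j
      have t1 := hRb s (e j) y
      have t2 := hRb s (-e j) y
      rw [norm_neg] at t2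
      rw [henorm, one_pow, one_mul] at t1 t2
      have t3 := (abs_sub (R s (e j) y) (R s (-e j) y)).trans (add_le_add t1 t2)
      have t4 := mul_le_mul (abs_apply_le_one_add_norm y j) t3 (abs_nonneg _) (by positivity)
      rw [abs_div, abs_mul, abs_two]
      linarith
    have d2 : ∀ j k, |y j * y k * (R s (e j + e k) y - R s (e j) y - R s (e k) y) / 2|
        ≤ 3 * G := by
      intro j k
      have t0 := hRb s (e j + e k) y
      have t1 := hRb s (e j) y
      have t2 := hRb s (e k) y
      have tn : ‖e j + e k‖ ^ 2 ≤ 4 := by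
        have := norm_add_le (e j) (e k)
        rw [henorm, henorm] at this
        nlinarith [norm_nonneg (e j + e k)]
      have t0' : |R s (e j + e k) y| ≤ |s| ^ 2 * (4 * g y) := t0.trans (by gcongr)
      rw [henorm, one_pow, one_mul] at t1 t2
      have t3 : |R s (e j + e k) y - R s (e j) y - R s (e k) y| ≤ 6 * (|s| ^ 2 * g y) := by
        have := abs_sub (R s (e j + e k) y - R s (e j) y) (R s (e k) y)
        have := abs_sub (R s (e j + e k) y) (R s (e j) y)
        linarith
      have t4 := mul_le_mul (habs2 j k y) t3 (abs_nonneg _) (by positivity)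
      rw [abs_div, abs_mul, abs_two]
      linarith
    rw [hrR]
    have s1 := (Finset.abs_sum_le_sum_abs (fun j => y j * (R s (e j) y - R s (-e j) y) / 2)
      Finset.univ).trans (Finset.sum_le_sum fun j _ => d1 j)
    have s2 := (Finset.abs_sum_le_sum_abs (fun j => ∑ k, y j * y k *
      (R s (e j + e k) y - R s (e j) y - R s (e k) y) / 2) Finset.univ).trans
      (Finset.sum_le_sum fun j _ => (Finset.abs_sum_le_sum_abs _ _).trans
        (Finset.sum_le_sum fun k _ => d2 j k))
    simp only [Finset.sum_const, Finset.card_univ, Fintype.card_fin, nsmul_eq_mul] at s1 s2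
    refine ((abs_sub _ _).trans (add_le_add ((abs_sub _ _).trans (add_le_add d0 s1)) s2)).trans_eq
      ?_
    rw [hG]
    ring
  · intro y
    set Q := fderiv ℝ (fderiv ℝ fun z => f z y) x₀ with hQ
    have hQsymm : ∀ u v, Q u v = Q v u :=
      (hd y).contDiffAt.isSymmSndFDerivAt (by simp)
    have hRo : ∀ v, (fun s => R s v y - s ^ 2 * (Q v v / 2)) =o[𝓝 0] fun s : ℝ => s ^ 2 :=
      fun v => (hd y).isLittleO_taylor_two_dir x₀ v
    have hQy : Q y y = ∑ j, ∑ k, y j * y k * Q (e j) (e k) := by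
      have : ∀ u, Q u y = ∑ k, y k * Q u (e k) := by
        intro u
        conv_lhs => arg 2; rw [pi_eq_sum_univ' y]
        simp [he]
      have h' : Q y y = ∑ j, y j * Q (e j) y := by
        rw [hQsymm]
        conv_lhs => arg 2; rw [pi_eq_sum_univ' y]
        simp [he, hQsymm y]
      rw [h']
      simp_rw [this, Finset.mul_sum, mul_assoc]
    have hsum := ((hRo y).sub (IsLittleO.fun_sum (s := Finset.univ) fun j _ =>
      ((hRo (e j)).sub (hRo (-e j))).const_mul_left (y j / 2))).sub
      (IsLittleO.fun_sum (s := Finset.univ) fun j _ =>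
        IsLittleO.fun_sum (s := Finset.univ) fun k _ =>
        (((hRo (e j + e k)).sub (hRo (e j))).sub (hRo (e k))).const_mul_left (y j * y k / 2))
    refine hsum.congr_left fun s => ?_
    rw [hrR]
    have g1 : ∀ j, y j / 2 * (R s (e j) y - s ^ 2 * (Q (e j) (e j) / 2)
        - (R s (-e j) y - s ^ 2 * (Q (-e j) (-e j) / 2)))
        = y j * (R s (e j) y - R s (-e j) y) / 2 := by
      intro j
      simp only [map_neg, neg_apply]
      ring
    have g2 : ∀ j k, y j * y k / 2 * (R s (e j + e k) y
        - s ^ 2 * (Q (e j + e k) (e j + e k) / 2) - (R s (e j) y - s ^ 2 * (Q (e j) (e j) / 2))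
        - (R s (e k) y - s ^ 2 * (Q (e k) (e k) / 2)))
        = y j * y k * (R s (e j + e k) y - R s (e j) y - R s (e k) y) / 2
          - s ^ 2 / 2 * (y j * y k * Q (e j) (e k)) := by
      intro j k
      simp only [map_add, add_apply, hQsymm (e k) (e j)]
      ring
    simp_rw [g1, g2, Finset.sum_sub_distrib, ← Finset.mul_sum]
    rw [hQy]
    ring

lemma dotProduct_self_nonneg {d : ℕ} (v : Fin d → ℝ) : 0 ≤ v ⬝ᵥ v :=
  Finset.sum_nonneg fun i _ => mul_self_nonneg (v i)

lemma sum_sum_eq_dotProduct_mulVec {d : ℕ} (A : Matrix (Fin d) (Fin d) ℝ) (v w : Fin d → ℝ) :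
    ∑ i, ∑ j, v i * A i j * w j = v ⬝ᵥ A.mulVec w := by
  simp only [dotProduct, Matrix.mulVec, Finset.mul_sum, mul_assoc]

/-- The matrix `A` is symmetric and its quadratic form lies between `c` and `C` times the
Euclidean one. -/
def Matrix.IsUniformlyElliptic {d : ℕ} (c C : ℝ) (A : Matrix (Fin d) (Fin d) ℝ) : Prop :=
  A.IsSymm ∧ ∀ v : Fin d → ℝ,
    c * (v ⬝ᵥ v) ≤ v ⬝ᵥ A.mulVec v ∧ v ⬝ᵥ A.mulVec v ≤ C * (v ⬝ᵥ v)

namespace Matrix.IsUniformlyElliptic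

variable {d : ℕ} {c C : ℝ} {A : Matrix (Fin d) (Fin d) ℝ}

lemma posDef (hA : A.IsUniformlyElliptic c C) (hc : 0 < c) : A.PosDef := by
  refine Matrix.PosDef.of_dotProduct_mulVec_pos ?_ fun x hx => ?_
  · rw [Matrix.IsHermitian, Matrix.conjTranspose_eq_transpose_of_trivial]; exact hA.1
  · have : 0 < star x ⬝ᵥ x := Matrix.dotProduct_star_self_pos_iff.2 hx
    rw [star_trivial] at this ⊢
    exact (mul_pos hc this).trans_le (hA.2 x).1

lemma abs_apply_le (hA : A.IsUniformlyElliptic c C) (hc : 0 < c) (i j : Fin d) : |A i j| ≤ C := by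
  have h1 := fun i : Fin d => (hA.2 (Pi.single i 1)).2
  have h2 := fun s : ℝ => (mul_nonneg hc.le (dotProduct_self_nonneg _)).trans
    (hA.2 (Pi.single i 1 + s • Pi.single j 1)).1
  have hs : A j i = A i j := hA.1.apply i j
  simp [Matrix.mulVec_add, Matrix.mulVec_smul, hs] at h1 h2
  have hp := h2 1
  have hm := h2 (-1)
  rw [abs_le]
  constructor <;> linarith [h1 i, h1 j]

lemma mulVec_inv_mulVec (hA : A.IsUniformlyElliptic c C) (hc : 0 < c) (y : Fin d → ℝ) :
    A.mulVec (A⁻¹.mulVec y) = y := by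
  rw [Matrix.mulVec_mulVec, Matrix.mul_nonsing_inv _ (hA.posDef hc).det_pos.ne'.isUnit,
    Matrix.one_mulVec]

lemma inv_isSymm (hA : A.IsUniformlyElliptic c C) : A⁻¹.IsSymm := by
  rw [Matrix.IsSymm, Matrix.transpose_nonsing_inv, hA.1.eq]

lemma abs_inv_apply_le (hA : A.IsUniformlyElliptic c C) (hc : 0 < c) (i j : Fin d) :
    |A⁻¹ i j| ≤ 1 / c := by
  have h := (hA.2 (A⁻¹.mulVec (Pi.single j 1))).1
  rw [hA.mulVec_inv_mulVec hc] at h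
  simp only [Matrix.mulVec_single_one, dotProduct_single_one, Matrix.col_apply] at h
  have h2 : ∀ k, c * (A⁻¹ k j) ^ 2 ≤ A⁻¹ j j := fun k => by
    refine le_trans (mul_le_mul_of_nonneg_left ?_ hc.le) h
    rw [sq]
    exact Finset.single_le_sum (f := fun k => A⁻¹.col j k * A⁻¹.col j k)
      (fun k _ => mul_self_nonneg _) (Finset.mem_univ k)
  have h3 : A⁻¹ j j ≤ 1 / c := by
    rw [le_div_iff₀ hc]
    by_contra! hlt
    have h0 : 0 < A⁻¹ j j := pos_of_mul_pos_left (zero_lt_one.trans hlt) hc.le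
    nlinarith [h2 j]
  refine abs_le_of_sq_le_sq ?_ (by positivity)
  have h4 := (h2 i).trans h3
  rw [div_pow, le_div_iff₀ (by positivity)]
  rw [le_div_iff₀ hc] at h4
  linarith

lemma norm_sq_le_inv (hA : A.IsUniformlyElliptic c C) (hc : 0 < c) (y : Fin d → ℝ) :
    c / (d * C ^ 2 + 1) * ‖y‖ ^ 2 ≤ y ⬝ᵥ A⁻¹.mulVec y := by
  set v := A⁻¹.mulVec y with hv
  have hy : A.mulVec v = y := hA.mulVec_inv_mulVec hc y
  have h1 := (hA.2 v).1
  rw [hy, dotProduct_comm v y] at h1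
  refine le_trans ?_ h1
  have hvv : 0 ≤ v ⬝ᵥ v := dotProduct_self_nonneg _
  have h2 : ‖y‖ ^ 2 ≤ (d * C ^ 2 + 1) * (v ⬝ᵥ v) := by
    have hC : 0 ≤ d * C ^ 2 := by positivity
    rw [← Real.sq_sqrt (show 0 ≤ (d * C ^ 2 + 1) * (v ⬝ᵥ v) by positivity)]
    gcongr
    refine (pi_norm_le_iff_of_nonneg (Real.sqrt_nonneg _)).2 fun i => ?_
    refine Real.le_sqrt_of_sq_le ?_
    have h3 : y i = ∑ j, A i j * v j := by rw [← hy]; rfl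
    have h4 : ∑ j, A i j ^ 2 ≤ d * C ^ 2 :=
      (Finset.sum_le_card_nsmul _ _ (C ^ 2) fun j _ =>
        sq_le_sq' (abs_le.1 (hA.abs_apply_le hc i j)).1 (abs_le.1 (hA.abs_apply_le hc i j)).2).trans
        (by simp)
    have h5 : ∑ j, v j ^ 2 = v ⬝ᵥ v := by simp [dotProduct, sq]
    rw [Real.norm_eq_abs, sq_abs, h3]
    refine (Finset.sum_mul_sq_le_sq_mul_sq _ _ _).trans ?_
    rw [h5]
    gcongr
    linarith
  rw [div_mul_eq_mul_div, div_le_iff₀ (by positivity)]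
  nlinarith

lemma det_le (hA : A.IsUniformlyElliptic c C) (hc : 0 < c) : A.det ≤ d.factorial • C ^ d := by
  have := Matrix.det_le (A := A) (abv := AbsoluteValue.abs) (x := C) (hA.abs_apply_le hc)
  simpa using (le_abs_self _).trans this

lemma le_det (hA : A.IsUniformlyElliptic c C) (hc : 0 < c) :
    (d.factorial • (1 / c) ^ d)⁻¹ ≤ A.det := by
  have := Matrix.det_le (A := A⁻¹) (abv := AbsoluteValue.abs) (x := 1 / c) (hA.abs_inv_apply_le hc)
  have h2 := (le_abs_self _).trans this
  rw [Matrix.det_nonsing_inv, Ring.inverse_eq_inv'] at h2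
  refine inv_le_of_inv_le₀ (hA.posDef hc).det_pos ?_
  simpa using h2

end Matrix.IsUniformlyElliptic

lemma abs_exp_sub_exp_le {a b E : ℝ} (ha : rexp a ≤ E) (hb : rexp b ≤ E) :
    |rexp b - rexp a| ≤ E * |b - a| := by
  have key : ∀ u v : ℝ, rexp v ≤ E → rexp v - rexp u ≤ E * |v - u| := by
    intro u v hv
    have h1 := Real.add_one_le_exp (u - v)
    rw [Real.exp_sub, le_div_iff₀ (Real.exp_pos v)] at h1
    calc rexp v - rexp u ≤ rexp v * (v - u) := by linarith
      _ ≤ rexp v * |v - u| := by gcongr; exact le_abs_self _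
      _ ≤ E * |v - u| := by gcongr
  rw [abs_le]
  refine ⟨?_, key a b hb⟩
  have := key b a ha
  rw [abs_sub_comm] at this
  linarith

lemma abs_exp_sub_exp_sub_le {a b E : ℝ} (ha : rexp a ≤ E) (hb : rexp b ≤ E) :
    |rexp b - rexp a - rexp a * (b - a)| ≤ E * |b - a| ^ 2 := by
  have h0 : rexp a * (b - a) ≤ rexp b - rexp a := by
    have h1 := Real.add_one_le_exp (b - a)
    rw [Real.exp_sub, le_div_iff₀ (Real.exp_pos a)] at h1
    linarith
  have h2 : rexp b - rexp a ≤ rexp b * (b - a) := by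
    have h1 := Real.add_one_le_exp (a - b)
    rw [Real.exp_sub, le_div_iff₀ (Real.exp_pos b)] at h1
    linarith
  have h3 := (le_abs_self _).trans (abs_mul (rexp b - rexp a) (b - a)).le
  rw [abs_of_nonneg (by linarith)]
  calc rexp b - rexp a - rexp a * (b - a) ≤ (rexp b - rexp a) * (b - a) := by linarith
    _ ≤ |rexp b - rexp a| * |b - a| := h3
    _ ≤ E * |b - a| * |b - a| := by gcongr; exact abs_exp_sub_exp_le ha hb
    _ = E * |b - a| ^ 2 := by ring

lemma one_le_one_add_norm {E : Type*} [NormedAddCommGroup E] (y : E) : 1 ≤ 1 + ‖y‖ := by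
  linarith [norm_nonneg y]

lemma abs_add_sum_sum_mul_le {d : ℕ} {M r : ℝ} {t : Fin d → Fin d → ℝ} {r₀ : ℝ}
    (h0 : |r₀| ≤ M * r) (ht : ∀ i j, |t i j| ≤ M * r) (hM : 0 ≤ M * r) (y : Fin d → ℝ) :
    |r₀ + ∑ i, ∑ j, y i * y j * t i j| ≤ (1 + d ^ 2) * M * (1 + ‖y‖) ^ 2 * r := by
  have h1 : ∀ i j, |y i * y j * t i j| ≤ (1 + ‖y‖) ^ 2 * (M * r) := fun i j => by
    rw [abs_mul, abs_mul, sq]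
    have := abs_apply_le_one_add_norm y i
    have := abs_apply_le_one_add_norm y j
    have := ht i j
    gcongr
  have h2 : |∑ i, ∑ j, y i * y j * t i j| ≤ d ^ 2 * ((1 + ‖y‖) ^ 2 * (M * r)) := by
    refine (Finset.abs_sum_le_sum_abs _ _).trans ?_
    refine (Finset.sum_le_sum fun i _ => (Finset.abs_sum_le_sum_abs _ _).trans
      (Finset.sum_le_sum fun j _ => h1 i j)).trans ?_
    simp [sq, mul_assoc]
  have h3 : 1 * (M * r) ≤ (1 + ‖y‖) ^ 2 * (M * r) := by
    gcongr
    exact one_le_pow₀ (one_le_one_add_norm y)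
  refine (abs_add_le _ _).trans ?_
  linarith

/-- First and second order Taylor bounds for the exponential of a quadratic polynomial in `y` whose
coefficients are `C²` bounded functions. -/
lemma exists_jet_bound_exp {d : ℕ} {ρ : (Fin d → ℝ) → ℝ} {q : Fin d → Fin d → (Fin d → ℝ) → ℝ}
    (hρ : ContDiff ℝ 2 ρ) (hq : ∀ i j, ContDiff ℝ 2 (q i j)) {K a : ℝ} (hρK : ∀ z, |ρ z| ≤ K)
    (hqK : ∀ i j z, |q i j z| ≤ K)
    (hle : ∀ z (y : Fin d → ℝ), ρ z + ∑ i, ∑ j, y i * y j * q i j z ≤ K - a * ‖y‖ ^ 2) (x₀ : Fin d → ℝ)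
    {N : (Fin d → ℝ) → (Fin d → ℝ) → ℝ}
    (hN : ∀ z y, N z y = rexp (ρ z + ∑ i, ∑ j, y i * y j * q i j z)) :
    ∃ M, 0 ≤ M ∧ (∀ z y, |N z y| ≤ M * ((1 + ‖y‖) ^ 4 * rexp (-a * ‖y‖ ^ 2))) ∧
      (∀ w y, |N (x₀ + w) y - N x₀ y| ≤ ‖w‖ * (M * ((1 + ‖y‖) ^ 4 * rexp (-a * ‖y‖ ^ 2)))) ∧
      ∀ w y, |N (x₀ + w) y - N x₀ y - fderiv ℝ (fun z => N z y) x₀ w|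
        ≤ ‖w‖ ^ 2 * (M * ((1 + ‖y‖) ^ 4 * rexp (-a * ‖y‖ ^ 2))) := by
  obtain ⟨A, hA, hA0⟩ := exists_bound_sub ((hρ.differentiable (by norm_num)) x₀) hρK
  obtain ⟨B, hB, hB0⟩ := exists_bound_sub_sub_fderiv hρ x₀ hρK
  choose A' hA' hA1 using fun i j => exists_bound_sub ((hq i j).differentiable (by norm_num) x₀)
    (hqK i j)
  choose B' hB' hB1 using fun i j => exists_bound_sub_sub_fderiv (hq i j) x₀ (hqK i j)
  set T := A + B + ∑ i, ∑ j, (A' i j + B' i j) with hT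
  have hTs : ∀ i j, A' i j + B' i j ≤ ∑ i, ∑ j, (A' i j + B' i j) := fun i j =>
    (Finset.single_le_sum (f := fun j => A' i j + B' i j)
      (fun j _ => add_nonneg (hA' i j) (hB' i j)) (Finset.mem_univ j)).trans
    (Finset.single_le_sum (f := fun i => ∑ j, (A' i j + B' i j))
      (fun i _ => Finset.sum_nonneg fun j _ => add_nonneg (hA' i j) (hB' i j)) (Finset.mem_univ i))
  have hT0 : 0 ≤ ∑ i, ∑ j, (A' i j + B' i j) :=
    Finset.sum_nonneg fun i _ => Finset.sum_nonneg fun j _ => add_nonneg (hA' i j) (hB' i j)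
  have hTn : 0 ≤ T := by positivity
  set S := (1 + (d : ℝ) ^ 2) * T with hS
  have hSn : 0 ≤ S := by positivity
  set φ : (Fin d → ℝ) → (Fin d → ℝ) → ℝ := fun z y => ρ z + ∑ i, ∑ j, y i * y j * q i j z with hφ
  have hφd : ∀ y, HasFDerivAt (fun z => φ z y)
      (fderiv ℝ ρ x₀ + ∑ i, ∑ j, (y i * y j) • fderiv ℝ (q i j) x₀) x₀ := fun y =>
    (hρ.differentiable (by norm_num) x₀).hasFDerivAt.add <| HasFDerivAt.fun_sum fun i _ =>
      HasFDerivAt.fun_sum fun j _ =>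
        ((hq i j).differentiable (by norm_num) x₀).hasFDerivAt.const_mul (y i * y j)
  have h1 : ∀ w y, |φ (x₀ + w) y - φ x₀ y| ≤ S * (1 + ‖y‖) ^ 2 * ‖w‖ := by
    intro w y
    have := abs_add_sum_sum_mul_le (M := T) (r := ‖w‖) (r₀ := ρ (x₀ + w) - ρ x₀)
      (t := fun i j => q i j (x₀ + w) - q i j x₀) ((hA0 w).trans (by gcongr; linarith))
      (fun i j => (hA1 i j w).trans (by gcongr; linarith [hTs i j, hB' i j])) (by positivity) y
    convert this using 2
    simp only [hφ, mul_sub, Finset.sum_sub_distrib]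
    ring
  have h2 : ∀ w y, |φ (x₀ + w) y - φ x₀ y
      - (fderiv ℝ ρ x₀ + ∑ i, ∑ j, (y i * y j) • fderiv ℝ (q i j) x₀) w|
      ≤ S * (1 + ‖y‖) ^ 2 * ‖w‖ ^ 2 := by
    intro w y
    have := abs_add_sum_sum_mul_le (M := T) (r := ‖w‖ ^ 2)
      (r₀ := ρ (x₀ + w) - ρ x₀ - fderiv ℝ ρ x₀ w)
      (t := fun i j => q i j (x₀ + w) - q i j x₀ - fderiv ℝ (q i j) x₀ w)
      ((hB0 w).trans (by gcongr; linarith))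
      (fun i j => (hB1 i j w).trans (by gcongr; linarith [hTs i j, hA' i j])) (by positivity) y
    convert this using 2
    simp only [hφ, mul_sub, Finset.sum_sub_distrib, add_apply, sum_apply,
      smul_apply, smul_eq_mul]
    ring
  have hE : ∀ z y, N z y ≤ rexp K * rexp (-a * ‖y‖ ^ 2) := fun z y => by
    rw [hN, ← Real.exp_add]
    exact Real.exp_le_exp.2 ((hle z y).trans (by linarith))
  have hN' : ∀ z y, N z y = rexp (φ z y) := hN
  have hfd : ∀ y, fderiv ℝ (fun z => N z y) x₀
      = N x₀ y • (fderiv ℝ ρ x₀ + ∑ i, ∑ j, (y i * y j) • fderiv ℝ (q i j) x₀) := fun y => by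
    simp only [hN']
    exact (hφd y).exp.fderiv
  refine ⟨rexp K * (1 + S + S ^ 2), by positivity, fun z y => ?_, fun w y => ?_, fun w y => ?_⟩
  · rw [abs_of_nonneg (by rw [hN]; positivity)]
    refine (hE z y).trans ?_
    have := one_le_pow₀ (one_le_one_add_norm y) (n := 4)
    calc rexp K * rexp (-a * ‖y‖ ^ 2) = rexp K * 1 * (1 * rexp (-a * ‖y‖ ^ 2)) := by ring
      _ ≤ _ := by gcongr; linarith [sq_nonneg S]
  · have h3 := abs_exp_sub_exp_le ((hN' x₀ y) ▸ hE x₀ y) ((hN' (x₀ + w) y) ▸ hE (x₀ + w) y)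
    rw [hN', hN']
    refine h3.trans ?_
    have h4 := h1 w y
    have h5 : (1 + ‖y‖) ^ 2 ≤ (1 + ‖y‖) ^ 4 := pow_le_pow_right₀ (one_le_one_add_norm y) (by norm_num)
    calc _ ≤ rexp K * rexp (-a * ‖y‖ ^ 2) * (S * (1 + ‖y‖) ^ 2 * ‖w‖) := by gcongr
      _ = ‖w‖ * (rexp K * S * ((1 + ‖y‖) ^ 2 * rexp (-a * ‖y‖ ^ 2))) := by ring
      _ ≤ _ := by gcongr; linarith [sq_nonneg S]
  · have h3 := abs_exp_sub_exp_sub_le ((hN' x₀ y) ▸ hE x₀ y) ((hN' (x₀ + w) y) ▸ hE (x₀ + w) y)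
    rw [hfd, smul_apply, smul_eq_mul]
    set L := (fderiv ℝ ρ x₀ + ∑ i, ∑ j, (y i * y j) • fderiv ℝ (q i j) x₀) w with hL
    rw [← hN', ← hN'] at h3
    have h4 := h1 w y
    have h6 := h2 w y
    have h5 : (1 + ‖y‖) ^ 2 ≤ (1 + ‖y‖) ^ 4 := pow_le_pow_right₀ (one_le_one_add_norm y) (by norm_num)
    have hN0 : 0 ≤ N x₀ y := by rw [hN]; positivity
    calc |N (x₀ + w) y - N x₀ y - N x₀ y * L|
        = |(N (x₀ + w) y - N x₀ y - N x₀ y * (φ (x₀ + w) y - φ x₀ y))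
          + N x₀ y * (φ (x₀ + w) y - φ x₀ y - L)| := by ring_nf
      _ ≤ rexp K * rexp (-a * ‖y‖ ^ 2) * |φ (x₀ + w) y - φ x₀ y| ^ 2
          + N x₀ y * |φ (x₀ + w) y - φ x₀ y - L| := by
        refine (abs_add_le _ _).trans (add_le_add h3 ?_)
        rw [abs_mul, abs_of_nonneg hN0]
      _ ≤ rexp K * rexp (-a * ‖y‖ ^ 2) * (S * (1 + ‖y‖) ^ 2 * ‖w‖) ^ 2
          + rexp K * rexp (-a * ‖y‖ ^ 2) * (S * (1 + ‖y‖) ^ 4 * ‖w‖ ^ 2) := by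
        gcongr
        · exact hE x₀ y
        · exact h6.trans (by gcongr)
      _ = ‖w‖ ^ 2 * (rexp K * (S + S ^ 2) * ((1 + ‖y‖) ^ 4 * rexp (-a * ‖y‖ ^ 2))) := by ring
      _ ≤ _ := by gcongr; linarith

lemma integrable_pow_mul_exp_norm {d : ℕ} (n : ℕ) (m : ℝ) {a : ℝ} (ha : 0 < a) :
    Integrable fun y : Fin d → ℝ => (1 + ‖y‖) ^ n * rexp (m * ‖y‖ - a * ‖y‖ ^ 2) := by
  have hb : 0 < a / 2 / (d + 1) := by positivity
  have hi : Integrable fun y : Fin d → ℝ => ∏ i, rexp (-(a / 2 / (d + 1)) * y i ^ 2) :=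
    Integrable.fintype_prod (f := fun _ (t : ℝ) => rexp (-(a / 2 / (d + 1)) * t ^ 2))
      fun _ => integrable_exp_neg_mul_sq hb
  refine (hi.const_mul (n.factorial * rexp (1 + (m + 1) ^ 2 / (2 * a)))).mono'
    (Continuous.aestronglyMeasurable (by fun_prop)) (ae_of_all _ fun y => ?_)
  rw [Real.norm_eq_abs, abs_of_nonneg (by positivity)]
  have h1 : (1 + ‖y‖) ^ n ≤ n.factorial * rexp (1 + ‖y‖) := by
    have := Real.pow_div_factorial_le_exp (1 + ‖y‖) (by positivity) n
    rw [div_le_iff₀ (by positivity)] at this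
    linarith
  have h2 : ∑ i, y i ^ 2 ≤ (d + 1) * ‖y‖ ^ 2 := by
    have : ∑ i, y i ^ 2 ≤ ∑ _i : Fin d, ‖y‖ ^ 2 := Finset.sum_le_sum fun i _ => by
      rw [← sq_abs]
      gcongr
      exact norm_le_pi_norm y i
    refine this.trans ?_
    simp only [Finset.sum_const, Finset.card_univ, Fintype.card_fin, nsmul_eq_mul]
    gcongr
    linarith
  have h3 : (m + 1) * ‖y‖ ≤ (m + 1) ^ 2 / (2 * a) + a / 2 * ‖y‖ ^ 2 := by
    rw [← sub_nonneg]
    have : (m + 1) ^ 2 / (2 * a) + a / 2 * ‖y‖ ^ 2 - (m + 1) * ‖y‖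
        = (m + 1 - a * ‖y‖) ^ 2 / (2 * a) := by field_simp; ring
    rw [this]
    positivity
  rw [← Real.exp_sum, ← Finset.mul_sum, mul_assoc, ← Real.exp_add]
  calc (1 + ‖y‖) ^ n * rexp (m * ‖y‖ - a * ‖y‖ ^ 2)
      ≤ n.factorial * rexp (1 + ‖y‖) * rexp (m * ‖y‖ - a * ‖y‖ ^ 2) := by gcongr
    _ = n.factorial * rexp (1 + (m + 1) * ‖y‖ - a * ‖y‖ ^ 2) := by
      rw [mul_assoc, ← Real.exp_add]
      ring_nf
    _ ≤ _ := by
      gcongr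
      have h4 : a / 2 / (d + 1) * ∑ i, y i ^ 2 ≤ a / 2 * ‖y‖ ^ 2 := by
        rw [div_mul_eq_mul_div, div_le_iff₀ (by positivity)]
        nlinarith
      linarith

lemma contDiff_det {d n : ℕ} {k : WithTop ℕ∞} {M : (Fin d → ℝ) → Matrix (Fin n) (Fin n) ℝ}
    (hM : ∀ i j, ContDiff ℝ k fun x => M x i j) : ContDiff ℝ k fun x => (M x).det := by
  simp only [Matrix.det_apply, zsmul_eq_mul, Units.smul_def]
  exact ContDiff.sum fun σ _ => contDiff_const.mul (contDiff_prod fun i _ => hM _ _)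

lemma contDiff_inv_apply {d n : ℕ} {k : WithTop ℕ∞} {M : (Fin d → ℝ) → Matrix (Fin n) (Fin n) ℝ}
    (hM : ∀ i j, ContDiff ℝ k fun x => M x i j) (h0 : ∀ x, (M x).det ≠ 0) (i j : Fin n) :
    ContDiff ℝ k fun x => (M x)⁻¹ i j := by
  simp only [Matrix.inv_def, Ring.inverse_eq_inv', Matrix.smul_apply, smul_eq_mul,
    Matrix.adjugate_apply]
  refine ((contDiff_det hM).inv h0).mul (contDiff_det fun a b => ?_)
  simp only [Matrix.updateRow_apply]
  split_ifs
  · exact contDiff_const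
  · exact hM a b

lemma gaussDensity_eq_exp {d : ℕ} {A : Matrix (Fin d) (Fin d) ℝ} (hA : A.PosDef)
    (y : Fin d → ℝ) :
    gaussDensity A y = rexp (-(Real.log ((4 * π) ^ d * A.det) / 2)
      + ∑ i, ∑ j, y i * y j * (-(A⁻¹ i j) / 4)) := by
  have h : 0 < (4 * π) ^ d * A.det := mul_pos (by positivity) hA.det_pos
  rw [gaussDensity, Real.exp_add, Real.exp_neg, ← Real.log_sqrt h.le,
    Real.exp_log (Real.sqrt_pos.2 h)]
  congr 2
  rw [← Finset.sum_neg_distrib, Finset.sum_div]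
  refine Finset.sum_congr rfl fun i _ => ?_
  rw [← Finset.sum_neg_distrib, Finset.sum_div]
  exact Finset.sum_congr rfl fun j _ => by ring

lemma exists_jet_bound_gaussDensity {d : ℕ} {D : (Fin d → ℝ) → Matrix (Fin d) (Fin d) ℝ}
    (hC2 : ∀ i j, ContDiff ℝ 2 (fun x => D x i j)) {c C : ℝ} (hc : 0 < c)
    (hD : ∀ x, (D x).IsUniformlyElliptic c C) (x₀ : Fin d → ℝ) :
    ∃ M a, 0 ≤ M ∧ 0 < a ∧
      (∀ z y, |gaussDensity (D z) y| ≤ M * ((1 + ‖y‖) ^ 4 * rexp (-a * ‖y‖ ^ 2))) ∧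
      (∀ w y, |gaussDensity (D (x₀ + w)) y - gaussDensity (D x₀) y|
        ≤ ‖w‖ * (M * ((1 + ‖y‖) ^ 4 * rexp (-a * ‖y‖ ^ 2)))) ∧
      ∀ w y, |gaussDensity (D (x₀ + w)) y - gaussDensity (D x₀) y
          - fderiv ℝ (fun z => gaussDensity (D z) y) x₀ w|
        ≤ ‖w‖ ^ 2 * (M * ((1 + ‖y‖) ^ 4 * rexp (-a * ‖y‖ ^ 2))) := by
  have hdet : ∀ x, 0 < (D x).det := fun x => ((hD x).posDef hc).det_pos
  have hpos : ∀ x, 0 < (4 * π) ^ d * (D x).det := fun x => mul_pos (by positivity) (hdet x)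
  have hρ : ContDiff ℝ 2 fun z => -(Real.log ((4 * π) ^ d * (D z).det) / 2) :=
    (((contDiff_const.mul (contDiff_det hC2)).log fun x => (hpos x).ne').div_const 2).neg
  have hq : ∀ i j, ContDiff ℝ 2 fun z => -((D z)⁻¹ i j) / 4 := fun i j =>
    (contDiff_inv_apply hC2 (fun x => (hdet x).ne') i j).neg.div_const 4
  obtain ⟨K, hK⟩ : ∃ K, ∀ z, |-(Real.log ((4 * π) ^ d * (D z).det) / 2)| ≤ K := by
    set l := (4 * π) ^ d * (d.factorial • (1 / c) ^ d)⁻¹ with hl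
    set u := (4 * π) ^ d * (d.factorial • C ^ d) with hu
    have hl0 : 0 < l := by
      rw [hl, nsmul_eq_mul]
      positivity
    refine ⟨|Real.log l| + |Real.log u|, fun z => ?_⟩
    have h1 := Real.log_le_log hl0 (mul_le_mul_of_nonneg_left ((hD z).le_det hc)
      (by positivity : 0 ≤ (4 * π) ^ d))
    have h2 := Real.log_le_log (hpos z) (mul_le_mul_of_nonneg_left ((hD z).det_le hc)
      (by positivity : 0 ≤ (4 * π) ^ d))
    rw [← hu] at h2
    rw [abs_le]
    have h3 := neg_abs_le (Real.log l)
    have h4 := le_abs_self (Real.log u)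
    have h5 := abs_nonneg (Real.log l)
    have h6 := abs_nonneg (Real.log u)
    constructor <;> linarith
  set a := c / (d * C ^ 2 + 1) / 4 with ha
  have hapos : 0 < a := by positivity
  obtain ⟨M, hM⟩ := exists_jet_bound_exp hρ hq (K := max K (1 / c)) (a := a)
    (fun z => (hK z).trans (le_max_left _ _))
    (fun i j z => by
      rw [abs_div, abs_neg, abs_of_pos (by norm_num : (0 : ℝ) < 4)]
      refine le_trans ?_ (((hD z).abs_inv_apply_le hc i j).trans (le_max_right _ _))
      linarith [abs_nonneg ((D z)⁻¹ i j)])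
    (fun z y => by
      have h1 := (hD z).norm_sq_le_inv hc y
      rw [← sum_sum_eq_dotProduct_mulVec] at h1
      have h2 : ∑ i, ∑ j, y i * y j * (-((D z)⁻¹ i j) / 4)
          = -(∑ i, ∑ j, y i * (D z)⁻¹ i j * y j) / 4 := by
        rw [← Finset.sum_neg_distrib, Finset.sum_div]
        refine Finset.sum_congr rfl fun i _ => ?_
        rw [← Finset.sum_neg_distrib, Finset.sum_div]
        exact Finset.sum_congr rfl fun j _ => by ring
      have h3 := (le_abs_self _).trans ((hK z).trans (le_max_left _ (1 / c)))
      rw [h2, ha]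
      linarith)
    x₀ (N := fun z y => gaussDensity (D z) y)
    fun z y => gaussDensity_eq_exp ((hD z).posDef hc) y
  exact ⟨M, a, hM.1, hapos, hM.2⟩

lemma contDiff_gaussDensity {d : ℕ} {D : (Fin d → ℝ) → Matrix (Fin d) (Fin d) ℝ}
    {k : WithTop ℕ∞} (hC : ∀ i j, ContDiff ℝ k (fun x => D x i j)) (hD : ∀ x, (D x).PosDef) :
    ContDiff ℝ k fun p : (Fin d → ℝ) × (Fin d → ℝ) => gaussDensity (D p.1) p.2 := by
  simp only [gaussDensity_eq_exp (hD _)]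
  have h0 : ∀ x, (4 * π) ^ d * (D x).det ≠ 0 := fun x =>
    (mul_pos (by positivity) (hD x).det_pos).ne'
  have h1 : ContDiff ℝ k fun p : (Fin d → ℝ) × (Fin d → ℝ) =>
      Real.log ((4 * π) ^ d * (D p.1).det) :=
    ((contDiff_const.mul (contDiff_det hC)).log h0).comp contDiff_fst
  have h2 : ∀ i j, ContDiff ℝ k fun p : (Fin d → ℝ) × (Fin d → ℝ) => (D p.1)⁻¹ i j := fun i j =>
    (contDiff_inv_apply hC (fun x => (hD x).det_pos.ne') i j).comp contDiff_fst
  have h3 : ∀ i, ContDiff ℝ k fun p : (Fin d → ℝ) × (Fin d → ℝ) => p.2 i := fun i =>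
    (contDiff_apply ℝ ℝ i).comp contDiff_snd
  exact ((h1.div_const 2).neg.add (ContDiff.sum fun i _ => ContDiff.sum fun j _ =>
    ((h3 i).mul (h3 j)).mul ((h2 i j).neg.div_const 4))).exp

/-- A kernel `N z y`, twice continuously differentiable in `z`, whose values and whose Taylor
remainders at `x₀` are dominated by a function of `y` with finite exponential moments. -/
structure DominatedKernel {d : ℕ} (x₀ : Fin d → ℝ) (N : (Fin d → ℝ) → (Fin d → ℝ) → ℝ)
    (g : (Fin d → ℝ) → ℝ) : Prop where
  continuous : Continuous fun p : (Fin d → ℝ) × (Fin d → ℝ) => N p.1 p.2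
  contDiff : ∀ y, ContDiff ℝ 2 fun z => N z y
  abs_le : ∀ z y, |N z y| ≤ g y
  abs_sub_le : ∀ w y, |N (x₀ + w) y - N x₀ y| ≤ ‖w‖ * g y
  abs_sub_sub_le : ∀ w y,
    |N (x₀ + w) y - N x₀ y - fderiv ℝ (fun z => N z y) x₀ w| ≤ ‖w‖ ^ 2 * g y
  integrable : ∀ (n : ℕ) (m : ℝ), Integrable fun y => (1 + ‖y‖) ^ n * (rexp (m * ‖y‖) * g y)

lemma exists_dominatedKernel_gaussDensity {d : ℕ} {D : (Fin d → ℝ) → Matrix (Fin d) (Fin d) ℝ}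
    (hC2 : ∀ i j, ContDiff ℝ 2 (fun x => D x i j)) {c C : ℝ} (hc : 0 < c)
    (hD : ∀ x, (D x).IsUniformlyElliptic c C) (x₀ : Fin d → ℝ) :
    ∃ g, DominatedKernel x₀ (fun z y => gaussDensity (D z) y) g := by
  obtain ⟨M, a, hM, ha, h0, h1, h2⟩ := exists_jet_bound_gaussDensity hC2 hc hD x₀
  have hcd := contDiff_gaussDensity hC2 fun x => (hD x).posDef hc
  refine ⟨_, hcd.continuous, fun y => hcd.comp (contDiff_id.prodMk contDiff_const), h0, h1, h2,
    fun n m => ?_⟩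
  refine ((integrable_pow_mul_exp_norm (n + 4) m ha).const_mul M).congr (ae_of_all _ fun y => ?_)
  simp only [sub_eq_add_neg, Real.exp_add, pow_add, neg_mul]
  ring

namespace DominatedKernel

variable {d : ℕ} {x₀ : Fin d → ℝ} {N : (Fin d → ℝ) → (Fin d → ℝ) → ℝ} {g : (Fin d → ℝ) → ℝ}

lemma nonneg (hN : DominatedKernel x₀ N g) (y : Fin d → ℝ) : 0 ≤ g y :=
  (abs_nonneg _).trans (hN.abs_le x₀ y)

lemma integrable_pow_mul (hN : DominatedKernel x₀ N g) (n : ℕ) :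
    Integrable fun y => (1 + ‖y‖) ^ n * g y := by
  simpa using hN.integrable n 0

lemma integrable_mul (hN : DominatedKernel x₀ N g) {q : (Fin d → ℝ) → ℝ} {n : ℕ} {k m : ℝ}
    (hu : Continuous q) (hq : ∀ y, |q y| ≤ k * ((1 + ‖y‖) ^ n * rexp (m * ‖y‖)))
    {z : (Fin d → ℝ) → Fin d → ℝ} (hz : Continuous z) :
    Integrable fun y => N (z y) y * q y := by
  refine ((hN.integrable n m).const_mul k).mono'
    ((hN.continuous.comp (hz.prodMk continuous_id)).mul hu).aestronglyMeasurable
    (ae_of_all _ fun y => ?_)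
  rw [Real.norm_eq_abs, abs_mul]
  refine (mul_le_mul (hN.abs_le _ y) (hq y) (abs_nonneg _) (hN.nonneg y)).trans (le_of_eq (by ring))

lemma abs_integral_mul_le (hN : DominatedKernel x₀ N g) {q : (Fin d → ℝ) → ℝ} {n : ℕ} {k m : ℝ}
    (hq : ∀ y, |q y| ≤ k * ((1 + ‖y‖) ^ n * rexp (m * ‖y‖))) (z : (Fin d → ℝ) → Fin d → ℝ) :
    |∫ y, N (z y) y * q y| ≤ k * ∫ y, (1 + ‖y‖) ^ n * (rexp (m * ‖y‖) * g y) := by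
  rw [← integral_const_mul, ← Real.norm_eq_abs]
  refine norm_integral_le_of_norm_le ((hN.integrable n m).const_mul k) (ae_of_all _ fun y => ?_)
  rw [Real.norm_eq_abs, abs_mul]
  refine (mul_le_mul (hN.abs_le _ y) (hq y) (abs_nonneg _) (hN.nonneg y)).trans (le_of_eq (by ring))

/-- First order expansion of `∫ (N q)(x₀ + s y, y) dy` in `s`. -/
lemma isLittleO_integral_mul_shift (hN : DominatedKernel x₀ N g)
    {q : (Fin d → ℝ) → (Fin d → ℝ) → ℝ} {n : ℕ} {k : ℝ}
    (hqc : Continuous fun p : (Fin d → ℝ) × (Fin d → ℝ) => q p.1 p.2)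
    (hqd : ∀ y, DifferentiableAt ℝ (fun z => q z y) x₀)
    (hq : ∀ z y, |q z y| ≤ k * (1 + ‖y‖) ^ n)
    (hq1 : ∀ w y, |q (x₀ + w) y - q x₀ y| ≤ ‖w‖ * (k * (1 + ‖y‖) ^ n)) :
    (fun s : ℝ => (∫ y, N (x₀ + s • y) y * q (x₀ + s • y) y) - (∫ y, N x₀ y * q x₀ y)
      - ∑ j, ((∫ y, y j * (N (x₀ + s • Pi.single j 1) y * q (x₀ + s • Pi.single j 1) y))
        - ∫ y, y j * (N x₀ y * q x₀ y)))
      =o[𝓝 0] fun s => s := by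
  have hk : ∀ y : Fin d → ℝ, 0 ≤ k * (1 + ‖y‖) ^ n := fun y => (abs_nonneg _).trans (hq x₀ y)
  refine isLittleO_integral_shift_one (f := fun z y => N z y * q z y)
    (g := fun y => 2 * k * ((1 + ‖y‖) ^ n * g y)) (hN.continuous.mul hqc)
    (fun y => ((hN.contDiff y).differentiable (by norm_num) x₀).mul (hqd y)) (fun z y => ?_)
    (fun w y => ?_) fun l => ?_
  · rw [abs_mul]
    have := mul_le_mul (hN.abs_le z y) (hq z y) (abs_nonneg _) (hN.nonneg y)
    have h0 := mul_nonneg (hk y) (hN.nonneg y)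
    linarith
  · have h1 := mul_le_mul (hN.abs_le (x₀ + w) y) (hq1 w y) (abs_nonneg _) (hN.nonneg y)
    have h2 := mul_le_mul (hN.abs_sub_le w y) (hq x₀ y) (abs_nonneg _)
      (mul_nonneg (norm_nonneg w) (hN.nonneg y))
    rw [← abs_mul] at h1 h2
    have h3 := abs_add_le (N (x₀ + w) y * (q (x₀ + w) y - q x₀ y))
      ((N (x₀ + w) y - N x₀ y) * q x₀ y)
    have h4 : N (x₀ + w) y * q (x₀ + w) y - N x₀ y * q x₀ y
      = N (x₀ + w) y * (q (x₀ + w) y - q x₀ y) + (N (x₀ + w) y - N x₀ y) * q x₀ y := by ring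
    rw [h4]
    linarith
  · refine ((hN.integrable_pow_mul (l + n)).const_mul (2 * k)).congr (ae_of_all _ fun y => ?_)
    simp only [pow_add]
    ring

lemma continuous_integral_mul_shift (hN : DominatedKernel x₀ N g)
    {q : (Fin d → ℝ) → (Fin d → ℝ) → ℝ} {n : ℕ} {k : ℝ}
    (hqc : Continuous fun p : (Fin d → ℝ) × (Fin d → ℝ) => q p.1 p.2)
    (hq : ∀ z y, |q z y| ≤ k * (1 + ‖y‖) ^ n) :
    Continuous fun s : ℝ => ∫ y, N (x₀ + s • y) y * q (x₀ + s • y) y := by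
  have hc := hN.continuous.mul hqc
  refine continuous_of_dominated (bound := fun y => k * ((1 + ‖y‖) ^ n * g y)) (fun s => ?_)
    (fun s => ae_of_all _ fun y => ?_) ((hN.integrable_pow_mul n).const_mul k)
    (ae_of_all _ fun y => ?_)
  · exact (hc.comp (f := fun y : Fin d → ℝ => (x₀ + s • y, y))
      (by fun_prop)).aestronglyMeasurable
  · rw [Real.norm_eq_abs, abs_mul]
    exact (mul_le_mul (hN.abs_le _ y) (hq _ y) (abs_nonneg _) (hN.nonneg y)).trans
      (le_of_eq (by ring))
  · exact hc.comp (f := fun s : ℝ => (x₀ + s • y, y)) (by fun_prop)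

end DominatedKernel

lemma Real.abs_exp_sub_sum_le (x : ℝ) (n : ℕ) :
    |rexp x - ∑ m ∈ Finset.range n, x ^ m / m.factorial| ≤ |x| ^ n * rexp |x| := by
  have := Complex.norm_exp_sub_sum_le_norm_mul_exp (x : ℂ) n
  rw [Complex.norm_real, Real.norm_eq_abs] at this
  rw [← Real.norm_eq_abs, ← Complex.norm_real]
  push_cast
  exact this

/-- Expansion of `exp (ε u - ε² v)` in powers of `ε`. -/
lemma abs_exp_expansion_le {ε u v k r : ℝ} (h0 : 0 ≤ ε) (h1 : ε ≤ 1) (hk : 0 ≤ k)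
    (hu : |u| ≤ k * r) (hv : |v| ≤ k) (hr : 1 ≤ r) :
    let W := 3 * ((1 + 2 * k) ^ 3 * r ^ 3) * rexp (2 * k * r)
    |rexp (ε * u - ε ^ 2 * v)| ≤ W ∧ |rexp (ε * u - ε ^ 2 * v) - 1| ≤ ε * W ∧
      |rexp (ε * u - ε ^ 2 * v) - 1 - ε * u| ≤ ε ^ 2 * W ∧
      |rexp (ε * u - ε ^ 2 * v) - 1 - ε * u - ε ^ 2 * (u ^ 2 / 2 - v)| ≤ ε ^ 3 * W := by
  intro W
  set x := ε * u - ε ^ 2 * v with hx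
  set E := rexp (2 * k * r) with hE
  have hE1 : 1 ≤ E := Real.one_le_exp (by positivity)
  have hr0 : 0 ≤ r := by linarith
  have hxk : |x| ≤ ε * (2 * k * r) := by
    have hε2 : ε ^ 2 ≤ ε := by nlinarith
    have hkr : k ≤ k * r := le_mul_of_one_le_right hk hr
    calc |x| ≤ |ε * u| + |ε ^ 2 * v| := abs_sub _ _
      _ = ε * |u| + ε ^ 2 * |v| := by
        rw [abs_mul, abs_mul, abs_of_nonneg h0, abs_of_nonneg (sq_nonneg ε)]
      _ ≤ ε * (k * r) + ε * (k * r) := by gcongr; exact hv.trans hkr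
      _ = ε * (2 * k * r) := by ring
  have hxE : rexp |x| ≤ E := by
    refine Real.exp_le_exp.2 (hxk.trans ?_)
    exact mul_le_of_le_one_left (by positivity) h1
  have hpow : ∀ n, |x| ^ n * rexp |x| ≤ ε ^ n * ((2 * k * r) ^ n * E) := fun n => by
    calc |x| ^ n * rexp |x| ≤ (ε * (2 * k * r)) ^ n * E := by gcongr
      _ = ε ^ n * ((2 * k * r) ^ n * E) := by ring
  have t := fun n => (Real.abs_exp_sub_sum_le x n).trans (hpow n)
  set A := (1 + 2 * k) ^ 3 * r ^ 3 with hA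
  have hAr : A = ((1 + 2 * k) * r) ^ 3 := by rw [hA]; ring
  have hA1 : 1 ≤ (1 + 2 * k) * r := by nlinarith
  have hkA : 2 * k * r ≤ (1 + 2 * k) * r := by nlinarith
  have hAn : ∀ n ≤ 3, (2 * k * r) ^ n ≤ A := fun n hn => by
    rw [hAr]
    exact (pow_le_pow_left₀ (by positivity) hkA n).trans (pow_le_pow_right₀ hA1 hn)
  have hW : ∀ n ≤ 3, (2 * k * r) ^ n * E ≤ A * E := fun n hn => by
    gcongr
    exact hAn n hn
  have hWe : W = 3 * (A * E) := by simp only [W]; ring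
  have hAE : 0 ≤ A * E := by positivity
  have hkA2 : k ≤ A * E := by
    have h2 : k ≤ A := by nlinarith [hAn 1 (by norm_num)]
    calc k ≤ A * 1 := by linarith
      _ ≤ A * E := by gcongr
  have hkrA : k ^ 2 * r ≤ A * E := by
    have h2 : k ^ 2 * r ≤ A := by nlinarith [hAn 2 (by norm_num), mul_nonneg (sq_nonneg k) hr0]
    calc k ^ 2 * r ≤ A * 1 := by linarith
      _ ≤ A * E := by gcongr
  refine ⟨?_, ?_, ?_, ?_⟩
  · have := (t 0).trans (mul_le_mul_of_nonneg_left (hW 0 (by norm_num)) (by positivity))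
    simp only [Finset.range_zero, Finset.sum_empty, sub_zero, pow_zero, one_mul] at this
    linarith
  · have := (t 1).trans (mul_le_mul_of_nonneg_left (hW 1 (by norm_num)) (by positivity))
    simp only [Finset.sum_range_succ, Finset.range_zero, Finset.sum_empty, pow_zero,
      Nat.factorial_zero, Nat.cast_one, pow_one] at this
    norm_num at this
    rw [hWe]
    nlinarith
  · have := (t 2).trans (mul_le_mul_of_nonneg_left (hW 2 (by norm_num)) (by positivity))
    simp only [Finset.sum_range_succ, Finset.range_zero, Finset.sum_empty, pow_zero,
      Nat.factorial_zero, Nat.factorial_one, Nat.cast_one, pow_one] at this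
    norm_num at this
    have h3 : |ε ^ 2 * v| ≤ ε ^ 2 * (A * E) := by
      rw [abs_mul, abs_of_nonneg (sq_nonneg ε)]
      gcongr
      exact hv.trans hkA2
    have h4 : rexp x - 1 - ε * u = rexp x - (1 + x) - ε ^ 2 * v := by rw [hx]; ring
    rw [h4, hWe]
    have := abs_sub (rexp x - (1 + x)) (ε ^ 2 * v)
    nlinarith [mul_nonneg (sq_nonneg ε) hAE]
  · have := (t 3).trans (mul_le_mul_of_nonneg_left (hW 3 (by norm_num)) (by positivity))
    simp only [Finset.sum_range_succ, Finset.range_zero, Finset.sum_empty, pow_zero,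
      Nat.factorial_zero, Nat.factorial_one, Nat.cast_one, pow_one, Nat.factorial_two] at this
    norm_num at this
    have h3 : |ε ^ 3 * (u * v)| ≤ ε ^ 3 * (A * E) := by
      rw [abs_mul, abs_of_nonneg (by positivity : 0 ≤ ε ^ 3), abs_mul]
      refine mul_le_mul_of_nonneg_left ?_ (by positivity)
      calc |u| * |v| ≤ (k * r) * k := by gcongr
        _ = k ^ 2 * r := by ring
        _ ≤ A * E := hkrA
    have h5 : |ε ^ 4 * (v ^ 2 / 2)| ≤ ε ^ 3 * (A * E) := by
      rw [abs_mul, abs_of_nonneg (by positivity : 0 ≤ ε ^ 4), abs_of_nonneg (by positivity)]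
      have h6 : ε ^ 4 ≤ ε ^ 3 := pow_le_pow_of_le_one h0 h1 (by norm_num)
      gcongr
      rw [← sq_abs]
      have : |v| ^ 2 ≤ k ^ 2 := by gcongr
      nlinarith [mul_nonneg (sq_nonneg k) hr0, mul_le_mul_of_nonneg_left hr (sq_nonneg k)]
    have h4 : rexp x - 1 - ε * u - ε ^ 2 * (u ^ 2 / 2 - v)
        = rexp x - (1 + x + x ^ 2 / 2) - ε ^ 3 * (u * v) + ε ^ 4 * (v ^ 2 / 2) := by
      rw [hx]; ring
    rw [h4, hWe]
    have h7 := abs_sub (rexp x - (1 + x + x ^ 2 / 2)) (ε ^ 3 * (u * v))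
    have h8 := abs_add_le (rexp x - (1 + x + x ^ 2 / 2) - ε ^ 3 * (u * v)) (ε ^ 4 * (v ^ 2 / 2))
    linarith

namespace DominatedKernel

variable {d : ℕ} {x₀ : Fin d → ℝ} {N : (Fin d → ℝ) → (Fin d → ℝ) → ℝ} {g : (Fin d → ℝ) → ℝ}

lemma integrable_mul_of_le_pow (hN : DominatedKernel x₀ N g) {q : (Fin d → ℝ) → ℝ} {n : ℕ} {k : ℝ}
    (hqc : Continuous q) (hq : ∀ y, |q y| ≤ k * (1 + ‖y‖) ^ n)
    {z : (Fin d → ℝ) → Fin d → ℝ} (hz : Continuous z) :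
    Integrable fun y => N (z y) y * q y :=
  hN.integrable_mul (n := n) (m := 0) hqc (fun y => by simpa using hq y) hz

/-- Expansion in powers of `ε` of the integrals of a kernel multiplied by `p y * exp (ε u - ε² v)`,
uniformly in the scale `s` of the shift. -/
lemma exists_integral_expansion_le (hN : DominatedKernel x₀ N g)
    {p : (Fin d → ℝ) → ℝ} {n : ℕ} (hp : Continuous p) (hpn : ∀ y, |p y| ≤ (1 + ‖y‖) ^ n)
    {u : (Fin d → ℝ) → (Fin d → ℝ) → ℝ} {v : (Fin d → ℝ) → ℝ} {k : ℝ} (hk : 0 ≤ k)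
    (huc : Continuous fun p : (Fin d → ℝ) × (Fin d → ℝ) => u p.1 p.2) (hvc : Continuous v)
    (hu : ∀ z y, |u z y| ≤ k * (1 + ‖y‖)) (hv : ∀ z, |v z| ≤ k) :
    ∃ B, ∀ ε s : ℝ, 0 ≤ ε → ε ≤ 1 →
      let I := fun q : (Fin d → ℝ) → (Fin d → ℝ) → ℝ =>
        ∫ y, N (x₀ + s • y) y * (p y * q (x₀ + s • y) y)
      let J := I fun z y => rexp (ε * u z y - ε ^ 2 * v z)
      |J| ≤ B ∧ |J - I fun _ _ => 1| ≤ ε * B ∧ |J - (I fun _ _ => 1) - ε * I u| ≤ ε ^ 2 * B ∧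
        |J - (I fun _ _ => 1) - ε * I u - ε ^ 2 * I fun z y => u z y ^ 2 / 2 - v z|
          ≤ ε ^ 3 * B := by
  set K := 3 * (1 + 2 * k) ^ 3 * rexp (2 * k) with hK
  refine ⟨K * ∫ y, (1 + ‖y‖) ^ (n + 3) * (rexp (2 * k * ‖y‖) * g y), fun ε s h0 h1 => ?_⟩
  intro I J
  have hz : Continuous fun y : Fin d → ℝ => x₀ + s • y := by fun_prop
  have hcu : Continuous fun y => u (x₀ + s • y) y := huc.comp (hz.prodMk continuous_id)
  have hcv : Continuous fun y => v (x₀ + s • y) := hvc.comp hz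
  have hexp := fun y => abs_exp_expansion_le h0 h1 hk (hu (x₀ + s • y) y) (hv (x₀ + s • y))
    (one_le_one_add_norm y)
  have hW : ∀ y : Fin d → ℝ, (1 + ‖y‖) ^ n *
      (3 * ((1 + 2 * k) ^ 3 * (1 + ‖y‖) ^ 3) * rexp (2 * k * (1 + ‖y‖)))
      = K * ((1 + ‖y‖) ^ (n + 3) * rexp (2 * k * ‖y‖)) := fun y => by
    rw [hK, mul_add, mul_one, Real.exp_add, pow_add]
    ring
  have hdom : ∀ {t : ℝ} {R : (Fin d → ℝ) → ℝ}, (∀ y, |R y| ≤ t *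
      (3 * ((1 + 2 * k) ^ 3 * (1 + ‖y‖) ^ 3) * rexp (2 * k * (1 + ‖y‖)))) →
      ∀ y, |p y * R y| ≤ t * K * ((1 + ‖y‖) ^ (n + 3) * rexp (2 * k * ‖y‖)) := by
    intro t R hR y
    rw [abs_mul, mul_assoc t, ← hW]
    exact (mul_le_mul (hpn y) (hR y) (abs_nonneg _) (by positivity)).trans (le_of_eq (by ring))
  have hbd : ∀ {t : ℝ} {R : (Fin d → ℝ) → ℝ}, (∀ y, |R y| ≤ t *
      (3 * ((1 + 2 * k) ^ 3 * (1 + ‖y‖) ^ 3) * rexp (2 * k * (1 + ‖y‖)))) →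
      |∫ y, N (x₀ + s • y) y * (p y * R y)|
        ≤ t * (K * ∫ y, (1 + ‖y‖) ^ (n + 3) * (rexp (2 * k * ‖y‖) * g y)) := fun hR =>
    (hN.abs_integral_mul_le (hdom hR) _).trans (le_of_eq (by ring))
  have iJ : Integrable fun y => N (x₀ + s • y) y *
      (p y * rexp (ε * u (x₀ + s • y) y - ε ^ 2 * v (x₀ + s • y))) :=
    hN.integrable_mul (by fun_prop) (hdom (t := 1) fun y => by simpa using (hexp y).1) hz
  have i0 : Integrable fun y => N (x₀ + s • y) y * (p y * 1) :=
    hN.integrable_mul_of_le_pow (k := 1) (n := n) (by fun_prop) (fun y => by simpa using hpn y) hz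
  have i1 : Integrable fun y => N (x₀ + s • y) y * (p y * u (x₀ + s • y) y) :=
    hN.integrable_mul_of_le_pow (k := k) (n := n + 1) (by fun_prop) (fun y => by
      rw [abs_mul]
      exact (mul_le_mul (hpn y) (hu _ y) (abs_nonneg _) (by positivity)).trans
        (le_of_eq (by ring))) hz
  have i2 : Integrable fun y => N (x₀ + s • y) y *
      (p y * (u (x₀ + s • y) y ^ 2 / 2 - v (x₀ + s • y))) :=
    hN.integrable_mul_of_le_pow (k := k ^ 2 + k) (n := n + 2) (by fun_prop) (fun y => by
      have h3 : |u (x₀ + s • y) y ^ 2 / 2 - v (x₀ + s • y)| ≤ (k ^ 2 + k) * (1 + ‖y‖) ^ 2 := by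
        refine (abs_sub _ _).trans ?_
        rw [abs_div, abs_pow, abs_two, add_mul]
        have h4 : |u (x₀ + s • y) y| ^ 2 ≤ (k * (1 + ‖y‖)) ^ 2 := by
          gcongr
          exact hu _ y
        have h5 : k * 1 ≤ k * (1 + ‖y‖) ^ 2 := by
          gcongr
          exact one_le_pow₀ (one_le_one_add_norm y)
        have := hv (x₀ + s • y)
        have := sq_nonneg (k * (1 + ‖y‖))
        nlinarith
      rw [abs_mul]
      exact (mul_le_mul (hpn y) h3 (abs_nonneg _) (by positivity)).trans
        (le_of_eq (by ring))) hz
  have i01 := iJ.sub i0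
  have i02 := i01.sub (i1.const_mul ε)
  simp only [Pi.sub_def] at i01 i02
  refine ⟨?_, ?_, ?_, ?_⟩
  · simpa using hbd (t := 1) (R := fun y => rexp (ε * u (x₀ + s • y) y - ε ^ 2 * v (x₀ + s • y)))
      fun y => by simpa using (hexp y).1
  · refine le_of_eq_of_le ?_ (hbd fun y => (hexp y).2.1)
    simp only [J, I]
    rw [← integral_sub iJ i0]
    congr 2
    ext y
    ring
  · refine le_of_eq_of_le ?_ (hbd fun y => (hexp y).2.2.1)
    simp only [J, I]
    rw [← integral_const_mul, ← integral_sub iJ i0, ← integral_sub i01 (i1.const_mul ε)]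
    congr 2
    ext y
    ring
  · refine le_of_eq_of_le ?_ (hbd fun y => (hexp y).2.2.2)
    simp only [J, I]
    rw [← integral_const_mul, ← integral_const_mul, ← integral_sub iJ i0,
      ← integral_sub i01 (i1.const_mul ε),
      ← integral_sub i02 (i2.const_mul (ε ^ 2))]
    congr 2
    ext y
    ring

end DominatedKernel

lemma pd2_eq_fderiv_fderiv {d : ℕ} {f : (Fin d → ℝ) → ℝ} (hf : ContDiff ℝ 2 f) (i j : Fin d)
    (x : Fin d → ℝ) :
    pd2 f i j x = fderiv ℝ (fderiv ℝ f) x (Pi.single i 1) (Pi.single j 1) := by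
  have h : DifferentiableAt ℝ (fderiv ℝ f) x :=
    (hf.fderiv_right (m := 1) (by norm_num)).differentiable (by norm_num) x
  simp only [pd2, pd]
  rw [fderiv_clm_apply h (differentiableAt_const _)]
  simp

lemma isLittleO_pd {d : ℕ} {f : (Fin d → ℝ) → ℝ} {x : Fin d → ℝ} (hf : DifferentiableAt ℝ f x)
    (j : Fin d) :
    (fun s : ℝ => f (x + s • Pi.single j 1) - f x - s * pd f j x) =o[𝓝 0] fun s => s := by
  have h := (hasFDerivAt_iff_isLittleO_nhds_zero.1 hf.hasFDerivAt).comp_tendsto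
    (k := fun s : ℝ => s • (Pi.single j 1 : Fin d → ℝ)) (l' := 𝓝 0)
    (Continuous.tendsto' (by fun_prop) _ _ (by simp))
  refine (h.trans_isBigO ?_).congr_left fun s => by simp [pd]
  refine IsBigO.of_bound ‖(Pi.single j 1 : Fin d → ℝ)‖ (Eventually.of_forall fun s => ?_)
  simp only [Function.comp, norm_smul]
  rw [mul_comm]

lemma abs_half_sum_mul_le {d : ℕ} {B : ℝ} {t : Fin d → ℝ} (ht : ∀ i, |t i| ≤ B) (y : Fin d → ℝ) :
    |(∑ i, y i * t i) / 2| ≤ d * B * (1 + ‖y‖) := by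
  have h1 : |∑ i, y i * t i| ≤ ∑ _i : Fin d, (1 + ‖y‖) * B :=
    (Finset.abs_sum_le_sum_abs _ _).trans (Finset.sum_le_sum fun i _ => by
      rw [abs_mul]
      exact mul_le_mul (abs_apply_le_one_add_norm y i) (ht i) (abs_nonneg _) (by positivity))
  rw [Finset.sum_const, Finset.card_univ, Fintype.card_fin, nsmul_eq_mul] at h1
  rw [abs_div, abs_two]
  linarith [abs_nonneg (∑ i, y i * t i)]

section

variable {d : ℕ} {D : (Fin d → ℝ) → Matrix (Fin d) (Fin d) ℝ} {x₀ : Fin d → ℝ}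
  {g : (Fin d → ℝ) → ℝ}

lemma isLittleO_integral_gaussDensity_shift (hC2 : ∀ i j, ContDiff ℝ 2 (fun x => D x i j))
    (hD : ∀ x, (D x).PosDef) (hN : DominatedKernel x₀ (fun z y => gaussDensity (D z) y) g) :
    (fun s : ℝ => (∫ y, gaussDensity (D (x₀ + s • y)) y) - 1
      - s ^ 2 * ∑ i, ∑ j, pd2 (fun x => D x i j) i j x₀) =o[𝓝 0] fun s => s ^ 2 := by
  have h1 := isLittleO_integral_shift_two (m := fun z j k => 2 * D z j k) hN.continuous hN.contDiff
    hN.abs_le hN.abs_sub_sub_le hN.integrable_pow_mul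
    (fun z j => integral_coord_mul_gaussDensity (D z) j)
    (fun z j k => integral_coord_mul_coord_mul_gaussDensity (hD z) j k)
  have h2 : (fun s : ℝ => ∑ j, ∑ k, (D (x₀ + s • (Pi.single j 1 + Pi.single k 1)) j k
      - D (x₀ + s • Pi.single j 1) j k - D (x₀ + s • Pi.single k 1) j k + D x₀ j k
      - s ^ 2 * pd2 (fun x => D x j k) j k x₀)) =o[𝓝 0] fun s => s ^ 2 :=
    IsLittleO.fun_sum fun j _ => IsLittleO.fun_sum fun k _ => by
      rw [pd2_eq_fderiv_fderiv (hC2 j k)]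
      exact (hC2 j k).isLittleO_second_difference x₀ (Pi.single j 1) (Pi.single k 1)
  refine (h1.add h2).congr_left fun s => ?_
  rw [integral_gaussDensity (hD x₀)]
  simp only [← mul_sub, ← mul_add, ← Finset.mul_sum, Finset.sum_sub_distrib]
  ring

variable {β : Fin d → (Fin d → ℝ) → ℝ}

lemma integrable_coord_mul_gaussDensity (hN : DominatedKernel x₀ (fun z y => gaussDensity (D z) y) g)
    (z : Fin d → ℝ) (i j : Fin d) : Integrable (fun y => y i * gaussDensity (D z) y) ∧
      Integrable (fun y => y i * y j * gaussDensity (D z) y) := by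
  have h1 := hN.integrable_mul_of_le_pow (q := fun y => y i) (n := 1) (k := 1) (by fun_prop)
    (fun y => by simpa using abs_apply_le_one_add_norm y i) (z := fun _ => z) continuous_const
  have h2 := hN.integrable_mul_of_le_pow (q := fun y => y i * y j) (n := 2) (k := 1) (by fun_prop)
    (fun y => by
      rw [abs_mul, one_mul, sq]
      have := abs_apply_le_one_add_norm y i
      have := abs_apply_le_one_add_norm y j
      gcongr) (z := fun _ => z) continuous_const
  exact ⟨by simpa only [mul_comm] using h1, by simpa only [mul_comm] using h2⟩

lemma integral_gaussDensity_mul_linear (hN : DominatedKernel x₀ (fun z y => gaussDensity (D z) y) g)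
    (z t : Fin d → ℝ) : ∫ y, gaussDensity (D z) y * ((∑ i, y i * t i) / 2) = 0 := by
  have h : ∀ y : Fin d → ℝ, gaussDensity (D z) y * ((∑ i, y i * t i) / 2)
      = ∑ i, t i / 2 * (y i * gaussDensity (D z) y) := fun y => by
    rw [Finset.sum_div, Finset.mul_sum]
    exact Finset.sum_congr rfl fun i _ => by ring
  simp_rw [h]
  rw [integral_finsetSum _ fun i _ =>
    (integrable_coord_mul_gaussDensity hN z i i).1.const_mul (t i / 2)]
  simp [integral_const_mul, integral_coord_mul_gaussDensity]

lemma integral_coord_mul_gaussDensity_mul_linear (hD : ∀ x, (D x).PosDef)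
    (hN : DominatedKernel x₀ (fun z y => gaussDensity (D z) y) g) (z t : Fin d → ℝ) (j : Fin d) :
    ∫ y, y j * (gaussDensity (D z) y * ((∑ i, y i * t i) / 2)) = ∑ i, D z j i * t i := by
  have h : ∀ y : Fin d → ℝ, y j * (gaussDensity (D z) y * ((∑ i, y i * t i) / 2))
      = ∑ i, t i / 2 * (y j * y i * gaussDensity (D z) y) := fun y => by
    rw [Finset.sum_div, Finset.mul_sum, Finset.mul_sum]
    exact Finset.sum_congr rfl fun i _ => by ring
  simp_rw [h]
  rw [integral_finsetSum _ fun i _ =>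
    (integrable_coord_mul_gaussDensity hN z j i).2.const_mul (t i / 2)]
  refine Finset.sum_congr rfl fun i _ => ?_
  rw [integral_const_mul, integral_coord_mul_coord_mul_gaussDensity (hD z)]
  ring

lemma integral_gaussDensity_mul_linear_sq (hD : ∀ x, (D x).PosDef)
    (hN : DominatedKernel x₀ (fun z y => gaussDensity (D z) y) g) (z t : Fin d → ℝ) (a : ℝ) :
    ∫ y, gaussDensity (D z) y * (((∑ i, y i * t i) / 2) ^ 2 / 2 - a)
      = (∑ j, t j * ∑ i, D z j i * t i) / 4 - a := by
  have h : ∀ y : Fin d → ℝ, gaussDensity (D z) y * (((∑ i, y i * t i) / 2) ^ 2 / 2 - a)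
      = ∑ j, t j / 4 * (y j * (gaussDensity (D z) y * ((∑ i, y i * t i) / 2)))
        - a * gaussDensity (D z) y := fun y => by
    have : ∑ j, t j / 4 * (y j * (gaussDensity (D z) y * ((∑ i, y i * t i) / 2)))
        = (∑ j, y j * t j) * (gaussDensity (D z) y * ((∑ i, y i * t i) / 2)) / 4 := by
      generalize gaussDensity (D z) y * ((∑ i, y i * t i) / 2) = G
      rw [Finset.sum_mul, Finset.sum_div]
      exact Finset.sum_congr rfl fun i _ => by ring
    rw [this]
    ring
  have hi : ∀ j, Integrable fun y : Fin d → ℝ =>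
      t j / 4 * (y j * (gaussDensity (D z) y * ((∑ i, y i * t i) / 2))) := fun j => by
    have h2 : ∀ y : Fin d → ℝ, y j * (gaussDensity (D z) y * ((∑ i, y i * t i) / 2))
        = ∑ i, t i / 2 * (y j * y i * gaussDensity (D z) y) := fun y => by
      rw [Finset.sum_div, Finset.mul_sum, Finset.mul_sum]
      exact Finset.sum_congr rfl fun i _ => by ring
    simp_rw [h2]
    exact (integrable_finsetSum _ fun i _ =>
      (integrable_coord_mul_gaussDensity hN z j i).2.const_mul (t i / 2)).const_mul _
  have h0 : Integrable fun y => gaussDensity (D z) y := by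
    simpa using hN.integrable_mul_of_le_pow (q := fun _ => 1) (n := 0) (k := 1) (by fun_prop)
      (by simp) (z := fun _ => z) continuous_const
  simp_rw [h]
  rw [integral_sub (integrable_finsetSum _ fun j _ => hi j) (h0.const_mul a),
    integral_finsetSum _ fun j _ => hi j, integral_const_mul, integral_gaussDensity (hD z)]
  simp only [integral_const_mul, integral_coord_mul_gaussDensity_mul_linear hD hN]
  rw [mul_one, Finset.sum_div]
  congr 1
  exact Finset.sum_congr rfl fun i _ => by ring

lemma isLittleO_integral_gaussDensity_mul_linear_shift (hD : ∀ x, (D x).PosDef)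
    (hC2 : ∀ i j, ContDiff ℝ 2 (fun x => D x i j))
    (hN : DominatedKernel x₀ (fun z y => gaussDensity (D z) y) g)
    (hβc : ∀ i, Continuous (β i)) (hβd : ∀ i, DifferentiableAt ℝ (β i) x₀) {K : ℝ}
    (hβK : ∀ i z, |β i z| ≤ K) :
    (fun s : ℝ => (∫ y, gaussDensity (D (x₀ + s • y)) y * ((∑ i, y i * β i (x₀ + s • y)) / 2))
      - s * ∑ j, pd (fun x => ∑ i, D x j i * β i x) j x₀) =o[𝓝 0] fun s => s := by
  choose A hA hA1 using fun i => exists_bound_sub (hβd i) (hβK i)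
  set T := max K 0 + ∑ i, A i with hT
  have hAT : ∀ i, A i ≤ T := fun i =>
    (Finset.single_le_sum (f := A) (fun i _ => hA i) (Finset.mem_univ i)).trans
      (by rw [hT]; linarith [le_max_right K 0])
  have hKT : ∀ i z, |β i z| ≤ T := fun i z => (hβK i z).trans ((le_max_left K 0).trans
    (by rw [hT]; linarith [Finset.sum_nonneg fun i (_ : i ∈ Finset.univ) => hA i]))
  have h1 := hN.isLittleO_integral_mul_shift (q := fun z y => (∑ i, y i * β i z) / 2) (n := 1)
    (k := d * T)
    ((continuous_finsetSum _ fun i _ => ((continuous_apply i).comp continuous_snd).mul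
      ((hβc i).comp continuous_fst)).div_const 2)
    (fun y => by fun_prop)
    (fun z y => by
      rw [pow_one]
      exact abs_half_sum_mul_le (fun i => hKT i z) y)
    (fun w y => by
      have := abs_half_sum_mul_le (B := T * ‖w‖) (t := fun i => β i (x₀ + w) - β i x₀)
        (fun i => (hA1 i w).trans (by gcongr; exact hAT i)) y
      rw [pow_one, ← sub_div, ← Finset.sum_sub_distrib]
      simp only [← mul_sub]
      exact this.trans (le_of_eq (by ring)))
  have h2 : (fun s : ℝ => ∑ j, ((∑ i, D (x₀ + s • Pi.single j 1) j i * β i (x₀ + s • Pi.single j 1))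
      - (∑ i, D x₀ j i * β i x₀) - s * pd (fun x => ∑ i, D x j i * β i x) j x₀))
      =o[𝓝 0] fun s => s := IsLittleO.fun_sum fun j _ => isLittleO_pd
    (f := fun x => ∑ i, D x j i * β i x) (DifferentiableAt.fun_sum fun i _ =>
      ((hC2 j i).differentiable (by norm_num) x₀).mul (hβd i)) j
  refine (h1.add h2).congr_left fun s => ?_
  simp only [integral_coord_mul_gaussDensity_mul_linear hD hN _ (fun i => β i _),
    integral_gaussDensity_mul_linear hN x₀ (fun i => β i x₀), Finset.sum_sub_distrib,
    Finset.mul_sum]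
  ring

lemma isLittleO_integral_gaussDensity_mul_coord_shift (hD : ∀ x, (D x).PosDef)
    (hC2 : ∀ i j, ContDiff ℝ 2 (fun x => D x i j))
    (hN : DominatedKernel x₀ (fun z y => gaussDensity (D z) y) g) (i : Fin d) :
    (fun s : ℝ => (∫ y, gaussDensity (D (x₀ + s • y)) y * y i)
      - s * (2 * ∑ j, pd (fun x => D x i j) j x₀)) =o[𝓝 0] fun s => s := by
  have h1 := hN.isLittleO_integral_mul_shift (q := fun _ y => y i) (n := 1) (k := 1)
    (by fun_prop) (fun y => by fun_prop)
    (fun z y => by simpa using abs_apply_le_one_add_norm y i)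
    (fun w y => by simp; positivity)
  have h2 : (fun s : ℝ => ∑ j, 2 * (D (x₀ + s • Pi.single j 1) i j - D x₀ i j
      - s * pd (fun x => D x i j) j x₀)) =o[𝓝 0] fun s => s := IsLittleO.fun_sum fun j _ =>
    (isLittleO_pd (f := fun x => D x i j) ((hC2 i j).differentiable (by norm_num) x₀)
      j).const_mul_left 2
  refine (h1.add h2).congr_left fun s => ?_
  have e1 : ∀ z, ∫ y : Fin d → ℝ, gaussDensity (D z) y * y i = 0 := fun z => by
    simpa only [mul_comm] using integral_coord_mul_gaussDensity (D z) i
  have e2 : ∀ z j, ∫ y : Fin d → ℝ, y j * (gaussDensity (D z) y * y i) = 2 * D z i j :=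
    fun z j => by
      rw [← integral_coord_mul_coord_mul_gaussDensity (hD z)]
      congr 1
      ext y
      ring
  simp only [e1, e2, mul_sub, Finset.sum_sub_distrib, Finset.mul_sum]
  ring_nf

end

lemma Asymptotics.IsLittleO.comp_const_mul_nhdsGT {f : ℝ → ℝ} {k : ℕ}
    (hf : f =o[𝓝 0] fun s => s ^ k) (α : ℝ) :
    (fun ε => f (α * ε)) =o[𝓝[>] 0] fun ε => ε ^ k := by
  have ht : Tendsto (fun ε : ℝ => α * ε) (𝓝[>] 0) (𝓝 0) :=
    (Continuous.tendsto' (by fun_prop) _ _ (by simp)).mono_left nhdsWithin_le_nhds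
  refine (hf.comp_tendsto ht).trans_isBigO ?_
  simp only [Function.comp_def, mul_pow]
  exact isBigO_const_mul_self _ _ _

lemma isLittleO_of_abs_le_pow_succ {f : ℝ → ℝ} {B : ℝ} {k : ℕ}
    (h : ∀ ε, 0 ≤ ε → ε ≤ 1 → |f ε| ≤ ε ^ (k + 1) * B) :
    f =o[𝓝[>] 0] fun ε => ε ^ k := by
  have h1 : f =O[𝓝[>] 0] fun ε => ε ^ (k + 1) := by
    refine IsBigO.of_bound |B| ?_
    filter_upwards [Ioc_mem_nhdsGT (zero_lt_one' ℝ)] with ε hε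
    have := h ε hε.1.le hε.2
    have hp : 0 < ε ^ (k + 1) := pow_pos hε.1 _
    rw [Real.norm_eq_abs, Real.norm_eq_abs, abs_of_pos hp]
    exact this.trans (by rw [mul_comm]; gcongr; exact le_abs_self B)
  refine h1.trans_isLittleO ?_
  exact (isLittleO_pow_pow (Nat.lt_succ_self k)).mono nhdsWithin_le_nhds

/-- Small-`ε` behaviour of the moments of the Gaussian kernel with covariance `2 D (x₀ + α ε y)`,
tilted by `exp (ε (y ⬝ β) / 2 - ε² v)`. -/
lemma gaussDensity_tilted_moments {d : ℕ} {D : (Fin d → ℝ) → Matrix (Fin d) (Fin d) ℝ}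
    {x₀ : Fin d → ℝ} {g : (Fin d → ℝ) → ℝ} {β : Fin d → (Fin d → ℝ) → ℝ} {v : (Fin d → ℝ) → ℝ}
    (hD : ∀ x, (D x).PosDef) (hC2 : ∀ i j, ContDiff ℝ 2 (fun x => D x i j))
    (hN : DominatedKernel x₀ (fun z y => gaussDensity (D z) y) g)
    (hβc : ∀ i, Continuous (β i)) (hβd : ∀ i, DifferentiableAt ℝ (β i) x₀) (hvc : Continuous v)
    {K : ℝ} (hβK : ∀ i z, |β i z| ≤ K) (hvK : ∀ z, |v z| ≤ K) (α : ℝ) :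
    let J := fun (p : (Fin d → ℝ) → ℝ) (ε : ℝ) =>
      ∫ y, gaussDensity (D (x₀ + (α * ε) • y)) y * (p y * rexp
        (ε * ((∑ i, y i * β i (x₀ + (α * ε) • y)) / 2) - ε ^ 2 * v (x₀ + (α * ε) • y)))
    (α ^ 2 * (∑ i, ∑ j, pd2 (fun x => D x i j) i j x₀)
        + α * (∑ j, pd (fun x => ∑ i, D x j i * β i x) j x₀)
        + ((∑ j, β j x₀ * ∑ i, D x₀ j i * β i x₀) / 4 - v x₀) = 0 →
      (fun ε => J (fun _ => 1) ε - 1) =o[𝓝[>] 0] fun ε => ε ^ 2) ∧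
    (∀ i, (fun ε => J (fun y => y i) ε - ε * ((∑ k, D x₀ i k * β k x₀)
      + α * (2 * ∑ j, pd (fun x => D x i j) j x₀))) =o[𝓝[>] 0] fun ε => ε ^ 1) ∧
    (∀ i j, (fun ε => J (fun y => y i * y j) ε - 2 * D x₀ i j) =o[𝓝[>] 0] fun ε => ε ^ 0) ∧
    ∀ (n : ℕ) (p : (Fin d → ℝ) → ℝ), Continuous p → (∀ y, |p y| ≤ (1 + ‖y‖) ^ n) →
      (fun ε => J p ε) =O[𝓝[>] 0] fun ε => ε ^ 0 := by
  intro J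
  have hK : 0 ≤ K := (abs_nonneg _).trans (hvK x₀)
  set u : (Fin d → ℝ) → (Fin d → ℝ) → ℝ := fun z y => (∑ i, y i * β i z) / 2 with hu
  have huc : Continuous fun p : (Fin d → ℝ) × (Fin d → ℝ) => u p.1 p.2 :=
    (continuous_finsetSum _ fun i _ => ((continuous_apply i).comp continuous_snd).mul
      ((hβc i).comp continuous_fst)).div_const 2
  set k := (d + 1) * K with hk
  have hk0 : 0 ≤ k := by positivity
  have huk : ∀ z y, |u z y| ≤ k * (1 + ‖y‖) := fun z y =>
    (abs_half_sum_mul_le (fun i => hβK i z) y).trans (by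
      rw [hk]
      gcongr
      linarith)
  have hvk : ∀ z, |v z| ≤ k := fun z => (hvK z).trans (by
    rw [hk]
    exact le_mul_of_one_le_left hK (by linarith [d.cast_nonneg (α := ℝ)]))
  have hexp := fun {p : (Fin d → ℝ) → ℝ} {n : ℕ} (hp : Continuous p)
    (hpn : ∀ y, |p y| ≤ (1 + ‖y‖) ^ n) =>
    hN.exists_integral_expansion_le hp hpn hk0 huc hvc huk hvk
  have hyc : ∀ i : Fin d, Continuous fun y : Fin d → ℝ => y i := fun i => continuous_apply i
  have hcont : ∀ {q : (Fin d → ℝ) → (Fin d → ℝ) → ℝ} {n : ℕ} {l : ℝ},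
      (Continuous fun p : (Fin d → ℝ) × (Fin d → ℝ) => q p.1 p.2) →
      (∀ z y, |q z y| ≤ l * (1 + ‖y‖) ^ n) →
      (fun ε : ℝ => (∫ y, gaussDensity (D (x₀ + (α * ε) • y)) y * q (x₀ + (α * ε) • y) y)
        - ∫ y, gaussDensity (D x₀) y * q x₀ y) =o[𝓝[>] 0] fun ε => ε ^ 0 := by
    intro q n l hq hql
    simp only [pow_zero]
    rw [isLittleO_one_iff]
    have hc := (hN.continuous_integral_mul_shift hq hql).comp (continuous_const_mul α)
    have := (hc.tendsto 0).mono_left (nhdsWithin_le_nhds (s := Set.Ioi 0))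
    simpa using this.sub_const (∫ y, gaussDensity (D x₀) y * q x₀ y)
  refine ⟨fun h => ?_, fun i => ?_, fun i j => ?_, fun n p hp hpn => ?_⟩
  · obtain ⟨B, hB⟩ := hexp (p := fun _ => 1) (n := 0) continuous_const (by simp)
    have e3 := isLittleO_of_abs_le_pow_succ (k := 2) (B := B) fun ε h0 h1 =>
      (hB ε (α * ε) h0 h1).2.2.2
    have e0 := (isLittleO_integral_gaussDensity_shift hC2 hD hN).comp_const_mul_nhdsGT α
    have e1 := ((isLittleO_integral_gaussDensity_mul_linear_shift hD hC2 hN hβc hβd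
      hβK).congr_right fun s => (pow_one s).symm).comp_const_mul_nhdsGT α
    have e2 := hcont (q := fun z y => u z y ^ 2 / 2 - v z) (n := 2) (l := k ^ 2 + k)
      (((huc.pow 2).div_const 2).sub (hvc.comp continuous_fst)) (fun z y => by
        refine (abs_sub _ _).trans ?_
        rw [abs_div, abs_pow, abs_two, add_mul]
        have h4 : |u z y| ^ 2 ≤ (k * (1 + ‖y‖)) ^ 2 := by
          gcongr
          exact huk z y
        have h5 : k * 1 ≤ k * (1 + ‖y‖) ^ 2 := by
          gcongr
          exact one_le_pow₀ (one_le_one_add_norm y)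
        have := hvk z
        have := sq_nonneg (k * (1 + ‖y‖))
        nlinarith)
    have e1' := (isBigO_refl (fun ε : ℝ => ε ^ 1) (𝓝[>] 0)).mul_isLittleO e1
    have e2' := (isBigO_refl (fun ε : ℝ => ε ^ 2) (𝓝[>] 0)).mul_isLittleO e2
    simp only [← pow_add, Nat.reduceAdd] at e1' e2'
    refine (((e3.add e0).add e1').add e2').congr_left fun ε => ?_
    simp only [hu, J] at h ⊢
    rw [integral_gaussDensity_mul_linear_sq hD hN x₀ (fun i => β i x₀)]
    simp only [one_mul, mul_one]
    linear_combination (-(ε ^ 2)) * h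
  · obtain ⟨B, hB⟩ := hexp (n := 1) (hyc i) fun y => by simpa using abs_apply_le_one_add_norm y i
    have e3 := isLittleO_of_abs_le_pow_succ (k := 1) (B := B) fun ε h0 h1 =>
      (hB ε (α * ε) h0 h1).2.2.1
    have e0 := ((isLittleO_integral_gaussDensity_mul_coord_shift hD hC2 hN i).congr_right
      fun s => (pow_one s).symm).comp_const_mul_nhdsGT α
    have e1 := hcont (q := fun z y => y i * u z y) (n := 2) (l := k)
      (((hyc i).comp continuous_snd).mul huc) (fun z y => by
        rw [abs_mul]
        exact (mul_le_mul (abs_apply_le_one_add_norm y i) (huk z y) (abs_nonneg _)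
          (by positivity)).trans (le_of_eq (by ring)))
    have e1' := (isBigO_refl (fun ε : ℝ => ε ^ 1) (𝓝[>] 0)).mul_isLittleO e1
    simp only [← pow_add, Nat.reduceAdd] at e1'
    refine ((e3.add e0).add e1').congr_left fun ε => ?_
    have e := integral_coord_mul_gaussDensity_mul_linear hD hN x₀ (fun i => β i x₀) i
    simp only [hu, J, mul_left_comm _ (gaussDensity _ _)] at e ⊢
    rw [e]
    simp only [mul_one]
    ring
  · obtain ⟨B, hB⟩ := hexp (p := fun y => y i * y j) (n := 2) ((hyc i).mul (hyc j)) fun y => by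
      rw [abs_mul, sq]
      have := abs_apply_le_one_add_norm y i
      have := abs_apply_le_one_add_norm y j
      gcongr
    have e3 := isLittleO_of_abs_le_pow_succ (k := 0) (B := B) fun ε h0 h1 => by
      rw [zero_add, pow_one]
      exact (hB ε (α * ε) h0 h1).2.1
    have e1 := hcont (q := fun z y => y i * y j) (n := 2) (l := 1)
      (by fun_prop) (fun z y => by
        rw [abs_mul, sq, one_mul]
        have := abs_apply_le_one_add_norm y i
        have := abs_apply_le_one_add_norm y j
        gcongr)
    refine (e3.add e1).congr_left fun ε => ?_
    rw [← integral_coord_mul_coord_mul_gaussDensity (hD x₀)]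
    simp only [J, mul_one, mul_comm _ (gaussDensity (D x₀) _)]
    ring
  · obtain ⟨B, hB⟩ := hexp hp hpn
    refine IsBigO.of_bound B ?_
    filter_upwards [Ioc_mem_nhdsGT (zero_lt_one' ℝ)] with ε hε
    simpa using (hB ε (α * ε) hε.1.le hε.2).1

/-- The drift `F - 2 α ∂ₖ Dʲᵏ` of the `α`-interpolated density. -/
noncomputable def interpDrift {d : ℕ} (D : (Fin d → ℝ) → Matrix (Fin d) (Fin d) ℝ)
    (F : (Fin d → ℝ) → Fin d → ℝ) (α : ℝ) (z : Fin d → ℝ) (j : Fin d) : ℝ :=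
  F z j - 2 * α * ∑ k, pd (fun y => D y j k) k z

/-- The linear coefficient `D⁻¹ b` of the tilt, where `b` is the interpolated drift. -/
noncomputable def interpTilt {d : ℕ} (D : (Fin d → ℝ) → Matrix (Fin d) (Fin d) ℝ)
    (F : (Fin d → ℝ) → Fin d → ℝ) (α : ℝ) (i : Fin d) (z : Fin d → ℝ) : ℝ :=
  ∑ j, (D z)⁻¹ i j * interpDrift D F α z j

/-- The order-`Δt` term in the exponent of the `α`-interpolated density. -/
noncomputable def interpPotential {d : ℕ} (D : (Fin d → ℝ) → Matrix (Fin d) (Fin d) ℝ)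
    (F : (Fin d → ℝ) → Fin d → ℝ) (α : ℝ) (z : Fin d → ℝ) : ℝ :=
  (∑ i, interpDrift D F α z i * interpTilt D F α i z) / 4
    + α * (∑ i, pd (fun y => F y i) i z)
    - α ^ 2 * ∑ i, ∑ j, pd2 (fun y => D y i j) i j z

lemma quadratic_form_sub {d : ℕ} {B : Matrix (Fin d) (Fin d) ℝ} (hB : B.IsSymm) {ε : ℝ}
    (hε : ε ≠ 0) (y b : Fin d → ℝ) :
    ∑ i, ∑ j, (ε * y i - b i * ε ^ 2) * (B i j / (4 * ε ^ 2)) * (ε * y j - b j * ε ^ 2)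
      = (∑ i, ∑ j, y i * B i j * y j) / 4 - ε * ((∑ i, y i * ∑ j, B i j * b j) / 2)
        + ε ^ 2 * ((∑ i, b i * ∑ j, B i j * b j) / 4) := by
  have hcross : ∑ i, ∑ j, b i * B i j * y j = ∑ i, y i * ∑ j, B i j * b j := by
    rw [Finset.sum_comm]
    refine Finset.sum_congr rfl fun i _ => ?_
    rw [Finset.mul_sum]
    refine Finset.sum_congr rfl fun j _ => ?_
    rw [hB.apply i j]
    ring
  have hterm : ∀ i j, (ε * y i - b i * ε ^ 2) * (B i j / (4 * ε ^ 2)) * (ε * y j - b j * ε ^ 2)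
      = y i * B i j * y j / 4 - ε / 4 * (y i * (B i j * b j)) - ε / 4 * (b i * B i j * y j)
        + ε ^ 2 / 4 * (b i * (B i j * b j)) := fun i j => by
    field_simp
    ring
  simp only [hterm, Finset.sum_add_distrib, Finset.sum_sub_distrib, ← Finset.mul_sum,
    ← Finset.sum_div, hcross]
  ring

section

variable {d : ℕ} {D : (Fin d → ℝ) → Matrix (Fin d) (Fin d) ℝ} {F : (Fin d → ℝ) → Fin d → ℝ}

lemma pow_mul_Galpha (α : ℝ) (x₀ y : Fin d → ℝ) {ε : ℝ} (hε : 0 < ε)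
    (hB : (D (x₀ + (α * ε) • y))⁻¹.IsSymm) :
    ε ^ d * Galpha d D F α x₀ (ε ^ 2) (x₀ + ε • y)
      = gaussDensity (D (x₀ + (α * ε) • y)) y * rexp
        (ε * ((∑ i, y i * interpTilt D F α i (x₀ + (α * ε) • y)) / 2)
          - ε ^ 2 * interpPotential D F α (x₀ + (α * ε) • y)) := by
  have hz : (fun i => x₀ i + α * ((x₀ + ε • y) i - x₀ i)) = x₀ + (α * ε) • y := by
    ext i
    simp only [Pi.add_apply, Pi.smul_apply, smul_eq_mul]
    ring
  simp only [Galpha, hz]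
  set z := x₀ + (α * ε) • y
  have hdrift : ∀ i, (x₀ + ε • y) i - x₀ i - F z i * ε ^ 2
      + 2 * α * (∑ k, pd (fun y => D y i k) k z) * ε ^ 2
      = ε * y i - interpDrift D F α z i * ε ^ 2 := fun i => by
    simp only [Pi.add_apply, Pi.smul_apply, smul_eq_mul, interpDrift]
    ring
  have hsqrt : √((4 * π * ε ^ 2) ^ d * (D z).det) = ε ^ d * √((4 * π) ^ d * (D z).det) := by
    rw [show (4 * π * ε ^ 2) ^ d * (D z).det = (ε ^ d) ^ 2 * ((4 * π) ^ d * (D z).det) by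
      rw [mul_pow]; ring, Real.sqrt_mul (by positivity), Real.sqrt_sq (by positivity)]
  simp only [hdrift]
  rw [quadratic_form_sub hB hε.ne', hsqrt, mul_inv, ← mul_assoc, ← mul_assoc,
    mul_inv_cancel₀ (by positivity), one_mul, gaussDensity,
    mul_assoc (√((4 * π) ^ d * (D z).det))⁻¹, ← Real.exp_add]
  congr 2
  simp only [interpPotential, interpTilt]
  ring

lemma integral_mul_Galpha (α : ℝ) (x₀ : Fin d → ℝ) (hB : ∀ x, (D x)⁻¹.IsSymm) {ε : ℝ}
    (hε : 0 < ε) (p : (Fin d → ℝ) → ℝ) :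
    ∫ x, p (x - x₀) * Galpha d D F α x₀ (ε ^ 2) x
      = ∫ y, gaussDensity (D (x₀ + (α * ε) • y)) y * (p (ε • y) * rexp
        (ε * ((∑ i, y i * interpTilt D F α i (x₀ + (α * ε) • y)) / 2)
          - ε ^ 2 * interpPotential D F α (x₀ + (α * ε) • y))) := by
  have h1 := integral_add_left_eq_self (μ := volume)
    (fun x => p (x - x₀) * Galpha d D F α x₀ (ε ^ 2) x) x₀
  have h2 := Measure.integral_comp_smul (volume : Measure (Fin d → ℝ))
    (fun x => p (x₀ + x - x₀) * Galpha d D F α x₀ (ε ^ 2) (x₀ + x)) ε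
  rw [h1, Module.finrank_fin_fun, abs_of_pos (by positivity), smul_eq_mul,
    eq_inv_mul_iff_mul_eq₀ (by positivity), ← integral_const_mul] at h2
  rw [← h2]
  congr 1
  ext y
  rw [add_sub_cancel_left, mul_left_comm, pow_mul_Galpha α x₀ y hε (hB _)]
  ring

lemma contDiff_pd {f : (Fin d → ℝ) → ℝ} {m n : WithTop ℕ∞} (hf : ContDiff ℝ n f) (hmn : m + 1 ≤ n)
    (k : Fin d) : ContDiff ℝ m fun x => pd f k x :=
  (hf.fderiv_right hmn).clm_apply contDiff_const

lemma contDiff_interpDrift (hC2 : ∀ i j, ContDiff ℝ 2 (fun x => D x i j))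
    (hF : ∀ i, ContDiff ℝ 1 (fun x => F x i)) (α : ℝ) (j : Fin d) :
    ContDiff ℝ 1 fun z => interpDrift D F α z j :=
  (hF j).sub (contDiff_const.mul
    (ContDiff.sum fun k _ => contDiff_pd (hC2 j k) (by norm_num) k))

lemma contDiff_interpTilt (hC2 : ∀ i j, ContDiff ℝ 2 (fun x => D x i j))
    (hF : ∀ i, ContDiff ℝ 1 (fun x => F x i)) (h0 : ∀ x, (D x).det ≠ 0) (α : ℝ) (i : Fin d) :
    ContDiff ℝ 1 (interpTilt D F α i) :=
  ContDiff.sum fun j _ => ((contDiff_inv_apply hC2 h0 i j).of_le (by norm_num)).mul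
    (contDiff_interpDrift hC2 hF α j)

lemma continuous_interpPotential (hC2 : ∀ i j, ContDiff ℝ 2 (fun x => D x i j))
    (hF : ∀ i, ContDiff ℝ 1 (fun x => F x i)) (h0 : ∀ x, (D x).det ≠ 0) (α : ℝ) :
    Continuous (interpPotential D F α) := by
  have h1 := fun i => (contDiff_interpDrift hC2 hF α i).continuous
  have h2 := fun i => (contDiff_interpTilt hC2 hF h0 α i).continuous
  have h3 := fun i => (contDiff_pd (m := 0) (hF i) (by norm_num) i).continuous
  have h4 : ∀ i j, Continuous (pd2 (fun x => D x i j) i j) := fun i j =>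
    (contDiff_pd (m := 0) (contDiff_pd (m := 1) (hC2 i j) (by norm_num) j) (by norm_num)
      i).continuous
  unfold interpPotential
  fun_prop

lemma abs_sum_le_card_mul {f : Fin d → ℝ} {B : ℝ} (hf : ∀ i, |f i| ≤ B) : |∑ i, f i| ≤ d * B :=
  (Finset.abs_sum_le_sum_abs _ _).trans
    ((Finset.sum_le_sum fun i _ => hf i).trans (by simp))

lemma exists_abs_interp_le {c C : ℝ} (hc : 0 < c) (hD : ∀ x, (D x).IsUniformlyElliptic c C)
    (hD1 : ∃ K : ℝ, ∀ (x : Fin d → ℝ) (i j k : Fin d), |pd (fun y => D y i j) k x| ≤ K)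
    (hD2 : ∃ K : ℝ, ∀ (x : Fin d → ℝ) (i j k l : Fin d), |pd2 (fun y => D y i j) k l x| ≤ K)
    (hFbdd : ∃ K : ℝ, ∀ (x : Fin d → ℝ) (i : Fin d), |F x i| ≤ K)
    (hF1 : ∃ K : ℝ, ∀ (x : Fin d → ℝ) (i k : Fin d), |pd (fun y => F y i) k x| ≤ K) (α : ℝ) :
    ∃ K : ℝ, (∀ i z, |interpTilt D F α i z| ≤ K) ∧ ∀ z, |interpPotential D F α z| ≤ K := by
  obtain ⟨K1, hK1⟩ := hD1
  obtain ⟨K2, hK2⟩ := hD2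
  obtain ⟨K3, hK3⟩ := hFbdd
  obtain ⟨K4, hK4⟩ := hF1
  have hb : ∀ z j, |interpDrift D F α z j| ≤ K3 + |2 * α| * (d * K1) := fun z j => by
    refine (abs_sub _ _).trans (add_le_add (hK3 z j) ?_)
    rw [abs_mul]
    gcongr
    exact abs_sum_le_card_mul fun k => hK1 z j k k
  set b := K3 + |2 * α| * (d * K1)
  have hβ : ∀ i z, |interpTilt D F α i z| ≤ d * (1 / c * b) := fun i z =>
    abs_sum_le_card_mul fun j => by
      rw [abs_mul]
      exact mul_le_mul ((hD z).abs_inv_apply_le hc i j) (hb z j) (abs_nonneg _) (by positivity)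
  have hv : ∀ z, |interpPotential D F α z|
      ≤ d * (b * (d * (1 / c * b))) / 4 + |α| * (d * K4) + |α ^ 2| * (d * (d * K2)) := fun z => by
    refine (abs_sub _ _).trans (add_le_add ((abs_add_le _ _).trans (add_le_add ?_ ?_)) ?_)
    · rw [abs_div, abs_of_pos (four_pos (α := ℝ))]
      gcongr
      refine abs_sum_le_card_mul fun i => ?_
      rw [abs_mul]
      exact mul_le_mul (hb z i) (hβ i z) (abs_nonneg _) ((abs_nonneg _).trans (hb z i))
    · rw [abs_mul]
      gcongr
      exact abs_sum_le_card_mul fun i => hK4 z i i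
    · rw [abs_mul]
      gcongr
      exact abs_sum_le_card_mul fun i => abs_sum_le_card_mul fun j => hK2 z i j i j
  exact ⟨_, fun i z => (hβ i z).trans (le_max_left _ _), fun z => (hv z).trans (le_max_right _ _)⟩

lemma sum_mul_interpTilt {c C : ℝ} (hc : 0 < c) {z : Fin d → ℝ}
    (hD : (D z).IsUniformlyElliptic c C) (α : ℝ) (j : Fin d) :
    ∑ i, D z j i * interpTilt D F α i z = interpDrift D F α z j :=
  congrFun (hD.mulVec_inv_mulVec hc (interpDrift D F α z)) j

lemma pd_interpDrift (hC2 : ∀ i j, ContDiff ℝ 2 (fun x => D x i j))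
    (hF : ∀ i, ContDiff ℝ 1 (fun x => F x i)) (α : ℝ) (j : Fin d) (x : Fin d → ℝ) :
    pd (fun z => interpDrift D F α z j) j x
      = pd (fun z => F z j) j x - 2 * α * ∑ k, pd2 (fun z => D z j k) j k x := by
  have h1 : ∀ k ∈ Finset.univ, DifferentiableAt ℝ (fun z => pd (fun y => D y j k) k z) x :=
    fun k _ => (contDiff_pd (m := 1) (hC2 j k) (by norm_num) k).differentiable (by norm_num) x
  have h2 : DifferentiableAt ℝ (fun z => F z j) x := (hF j).differentiable (by norm_num) x
  simp only [pd2]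
  unfold interpDrift
  rw [pd, fderiv_fun_sub h2 ((DifferentiableAt.fun_sum h1).const_mul _),
    fderiv_const_mul (DifferentiableAt.fun_sum h1), fderiv_fun_sum h1]
  simp [pd]

end

lemma isLittleO_of_comp_sq {f : ℝ → ℝ} {h : ℝ → ℝ} (hf : h =o[𝓝[>] 0] fun ε => ε ^ 2)
    (hfh : ∀ ε, 0 < ε → f (ε ^ 2) = h ε) : f =o[𝓝[>] 0] fun t => t := by
  have ht : Tendsto (fun t : ℝ => √t) (𝓝[>] 0) (𝓝[>] 0) :=
    tendsto_nhdsWithin_iff.2 ⟨(Continuous.tendsto' Real.continuous_sqrt _ _ (by simp)).mono_left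
      nhdsWithin_le_nhds, by
        filter_upwards [self_mem_nhdsWithin] with t ht using Real.sqrt_pos.2 ht⟩
  refine (hf.comp_tendsto ht).congr' ?_ ?_ <;>
    filter_upwards [self_mem_nhdsWithin] with t (ht : 0 < t)
  · rw [Function.comp, ← hfh _ (Real.sqrt_pos.2 ht), Real.sq_sqrt ht.le]
  · rw [Function.comp, Real.sq_sqrt ht.le]

/-- Lemma 3, moment form: for every `α ∈ [0,1]` and every `x₀`,
the α-interpolated time-slice density has the same moments as the `α = 0`
Gaussian representation up to order `Δt`, as `Δt → 0⁺`. -/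
theorem Galpha_moments (d : ℕ) (hd : 1 ≤ d)
    (D : (Fin d → ℝ) → Matrix (Fin d) (Fin d) ℝ)
    (hsymm : ∀ x, (D x).IsSymm)
    (hC2 : ∀ i j, ContDiff ℝ 2 (fun x => D x i j))
    (c C : ℝ) (hc : 0 < c)
    (hell : ∀ (x v : Fin d → ℝ),
      c * (∑ i, (v i)^2) ≤ (∑ i, ∑ j, v i * D x i j * v j) ∧
      (∑ i, ∑ j, v i * D x i j * v j) ≤ C * (∑ i, (v i)^2))
    (hD1 : ∃ K : ℝ, ∀ (x : Fin d → ℝ) (i j k : Fin d),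
      |pd (fun y => D y i j) k x| ≤ K)
    (hD2 : ∃ K : ℝ, ∀ (x : Fin d → ℝ) (i j k l : Fin d),
      |pd2 (fun y => D y i j) k l x| ≤ K)
    (F : (Fin d → ℝ) → Fin d → ℝ)
    (hFC1 : ∀ i, ContDiff ℝ 1 (fun x => F x i))
    (hFbdd : ∃ K : ℝ, ∀ (x : Fin d → ℝ) (i : Fin d), |F x i| ≤ K)
    (hF1 : ∃ K : ℝ, ∀ (x : Fin d → ℝ) (i k : Fin d),
      |pd (fun y => F y i) k x| ≤ K) :
    ∀ α ∈ Set.Icc (0:ℝ) 1, ∀ x₀ : Fin d → ℝ,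
      ((fun Δt : ℝ => (∫ x : Fin d → ℝ, Galpha d D F α x₀ Δt x) - 1)
          =o[𝓝[>] (0:ℝ)] fun Δt => Δt) ∧
      (∀ i, (fun Δt : ℝ =>
          (∫ x : Fin d → ℝ, (x i - x₀ i) * Galpha d D F α x₀ Δt x) - F x₀ i * Δt)
          =o[𝓝[>] (0:ℝ)] fun Δt => Δt) ∧
      (∀ i j, (fun Δt : ℝ =>
          (∫ x : Fin d → ℝ, (x i - x₀ i) * (x j - x₀ j) * Galpha d D F α x₀ Δt x)
            - 2 * D x₀ i j * Δt)
          =o[𝓝[>] (0:ℝ)] fun Δt => Δt) ∧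
      (∀ M : ℕ, 3 ≤ M → ∀ idx : Fin M → Fin d,
        (fun Δt : ℝ =>
          ∫ x : Fin d → ℝ, (∏ a : Fin M, (x (idx a) - x₀ (idx a))) * Galpha d D F α x₀ Δt x)
          =o[𝓝[>] (0:ℝ)] fun Δt => Δt) := by
  intro α _ x₀
  have hE : ∀ x, (D x).IsUniformlyElliptic c C := fun x => ⟨hsymm x, fun v => by
    have h := hell x v
    rw [sum_sum_eq_dotProduct_mulVec] at h
    simpa only [dotProduct, ← sq] using h⟩
  have hP : ∀ x, (D x).PosDef := fun x => (hE x).posDef hc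
  have h0 : ∀ x, (D x).det ≠ 0 := fun x => (hP x).det_pos.ne'
  obtain ⟨g, hN⟩ := exists_dominatedKernel_gaussDensity hC2 hc hE x₀
  obtain ⟨K, hβK, hvK⟩ := exists_abs_interp_le (F := F) hc hE hD1 hD2 hFbdd hF1 α
  have hβ := contDiff_interpTilt hC2 hFC1 h0 α
  have hG := fun {ε : ℝ} (hε : 0 < ε) => integral_mul_Galpha (F := F) α x₀
    (fun x => (hE x).inv_isSymm) hε
  obtain ⟨m0, m1, m2, mn⟩ := gaussDensity_tilted_moments hP hC2 hN (fun i => (hβ i).continuous)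
    (fun i => (hβ i).differentiable (by norm_num) x₀) (continuous_interpPotential hC2 hFC1 h0 α)
    hβK hvK α
  have hDβ := fun x => sum_mul_interpTilt (F := F) hc (hE x) α
  have hpow : ∀ k : ℕ, (fun ε : ℝ => ε ^ k) =O[𝓝[>] 0] fun ε => ε ^ k := fun k =>
    isBigO_refl _ _
  refine ⟨?_, fun i => ?_, fun i j => ?_, fun M hM idx => ?_⟩
  · refine isLittleO_of_comp_sq (m0 ?_) fun ε hε => ?_
    · simp only [hDβ, pd_interpDrift hC2 hFC1, Finset.sum_sub_distrib, ← Finset.mul_sum]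
      simp only [interpPotential, mul_comm (interpTilt D F α _ _)]
      ring
    · have := hG hε fun _ => 1
      simp only [one_mul] at this ⊢
      rw [this]
  · have m1' := (hpow 1).mul_isLittleO (m1 i)
    simp only [← pow_add, Nat.reduceAdd] at m1'
    refine isLittleO_of_comp_sq m1' fun ε hε => ?_
    have h := hG hε fun y => y i
    simp only [Pi.sub_apply, Pi.smul_apply, smul_eq_mul, mul_assoc ε, mul_left_comm _ ε,
      integral_const_mul] at h ⊢
    rw [h, hDβ, interpDrift]
    ring
  · have m2' := (hpow 2).mul_isLittleO (m2 i j)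
    simp only [← pow_add, Nat.reduceAdd] at m2'
    refine isLittleO_of_comp_sq m2' fun ε hε => ?_
    have h := hG hε fun y => y i * y j
    simp only [Pi.sub_apply, Pi.smul_apply, smul_eq_mul, mul_mul_mul_comm ε, ← sq ε,
      mul_assoc (ε ^ 2) (_ * _), mul_left_comm _ (ε ^ 2) (_ * _), integral_const_mul] at h ⊢
    rw [h]
    ring
  · have hle : ∀ y : Fin d → ℝ, |∏ a, y (idx a)| ≤ (1 + ‖y‖) ^ M := fun y => by
      rw [Finset.abs_prod]
      refine (Finset.prod_le_prod (fun _ _ => abs_nonneg _)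
        fun a _ => abs_apply_le_one_add_norm y (idx a)).trans (by simp)
    have mM := (hpow M).mul (mn M (fun y => ∏ a, y (idx a)) (by fun_prop) hle)
    simp only [← pow_add, add_zero] at mM
    refine isLittleO_of_comp_sq (mM.trans_isLittleO
      ((isLittleO_pow_pow (show 2 < M by lia)).mono nhdsWithin_le_nhds)) fun ε hε => ?_
    have h := hG hε fun y => ∏ a, y (idx a)
    simp only [Pi.sub_apply, Pi.smul_apply, smul_eq_mul, Finset.prod_mul_distrib,
      Finset.prod_const, Finset.card_univ, Fintype.card_fin, mul_assoc (ε ^ M),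
      mul_left_comm _ (ε ^ M), integral_const_mul] at h ⊢
    rw [h]
end

section
/- (Covariance of the classical α = 0 time-slice action under Ito's formula) Fix x₀ ∈ U, Δt > 0 and Δx ∈ ℝ^d, and define the Ito-transformed increment Δy^a = (∂φ^a/∂x^i)(x₀) Δx^i + B^{ij}(x₀) (∂²φ^a/∂x^i ∂x^j)(x₀) Δt. Then: (a) Δy^a − F'^a(φ(x₀)) Δt = (∂φ^a/∂x^i)(x₀) ( Δx^i − F^i(x₀) Δt ) for each a, i.e. the combination Δx^i − F^i Δt transforms as a contravariant vector; and (b) ( Δy^a − F'^a Δt ) B'⁻¹_{ab}(φ(x₀)) ( Δy^b − F'^b Δt ) = ( Δx^i − F^i Δt ) B⁻¹_{ij}(x₀) ( Δx^j − F^j Δt ), so the α = 0 time-slice action (Δx − FΔt)^T B⁻¹ (Δx − FΔt)/(4Δt) is invariant. -/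
open Real

/-- The transformed (covariant) metric
`g'_{ab}(y) = (∂ψ^i/∂y^a) g_{ij}(ψ(y)) (∂ψ^j/∂y^b)`. -/
noncomputable def metricP (d : ℕ) (ψ : (Fin d → ℝ) → (Fin d → ℝ))
    (g : (Fin d → ℝ) → Matrix (Fin d) (Fin d) ℝ)
    (y : Fin d → ℝ) : Matrix (Fin d) (Fin d) ℝ :=
  Matrix.of fun a b => ∑ i, ∑ j,
    pd (fun z => ψ z i) a y * g (ψ y) i j * pd (fun z => ψ z j) b y

/-- The transformed (contravariant) tensor
`L'^{ab}(y) = (∂φ^a/∂x^i)(ψ(y)) L^{ij}(ψ(y)) (∂φ^b/∂x^j)(ψ(y))`. -/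
noncomputable def tensorP (d : ℕ) (φ ψ : (Fin d → ℝ) → (Fin d → ℝ))
    (L : (Fin d → ℝ) → Matrix (Fin d) (Fin d) ℝ)
    (y : Fin d → ℝ) : Matrix (Fin d) (Fin d) ℝ :=
  Matrix.of fun a b => ∑ i, ∑ j,
    pd (fun z => φ z a) i (ψ y) * L (ψ y) i j * pd (fun z => φ z b) j (ψ y)

/-- The symmetric part `B^{ij} = ½(L^{ij} + L^{ji})`. -/
noncomputable def symPart (d : ℕ) (L : (Fin d → ℝ) → Matrix (Fin d) (Fin d) ℝ)
    (x : Fin d → ℝ) : Matrix (Fin d) (Fin d) ℝ :=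
  Matrix.of fun i j => (L x i j + L x j i) / 2

/-- The classical drift `F^i(x) = (1/√det g) ∂_j(√det g L^{ij})(x) − L^{ij} ∂_j U_pot(x)`. -/
noncomputable def classDrift (d : ℕ)
    (g L : (Fin d → ℝ) → Matrix (Fin d) (Fin d) ℝ)
    (Upot : (Fin d → ℝ) → ℝ) (x : Fin d → ℝ) (i : Fin d) : ℝ :=
  (Real.sqrt (g x).det)⁻¹ *
    (∑ j, pd (fun z => Real.sqrt (g z).det * L z i j) j x) -
  ∑ j, L x i j * pd Upot j x


section PartialDerivatives

open Filter Topology Matrix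

variable {d : ℕ} {f f₁ f₂ : (Fin d → ℝ) → ℝ} {x : Fin d → ℝ}

lemma pd_congr (h : f₁ =ᶠ[𝓝 x] f₂) (k : Fin d) : pd f₁ k x = pd f₂ k x := by
  simp only [pd, h.fderiv_eq]

lemma pd_mul (h₁ : DifferentiableAt ℝ f₁ x) (h₂ : DifferentiableAt ℝ f₂ x) (k : Fin d) :
    pd (fun z => f₁ z * f₂ z) k x = pd f₁ k x * f₂ x + f₁ x * pd f₂ k x := by
  simp only [pd, fderiv_fun_mul h₁ h₂, _root_.add_apply,
    _root_.smul_apply, smul_eq_mul]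
  ring

lemma pd_sum {ι : Type*} (s : Finset ι) {F : ι → (Fin d → ℝ) → ℝ}
    (h : ∀ i ∈ s, DifferentiableAt ℝ (F i) x) (k : Fin d) :
    pd (fun z => ∑ i ∈ s, F i z) k x = ∑ i ∈ s, pd (F i) k x := by
  simp only [pd, fderiv_fun_sum h, _root_.sum_apply]

lemma pd_const (c : ℝ) (k : Fin d) : pd (fun _ => c) k x = 0 := by
  simp [pd]

lemma pd_coord (i k : Fin d) :
    pd (fun z => z i) k x = (1 : Matrix (Fin d) (Fin d) ℝ) i k := by
  have h : HasFDerivAt (fun z : Fin d → ℝ => z i)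
      (ContinuousLinearMap.proj (R := ℝ) (φ := fun _ : Fin d => ℝ) i) x := hasFDerivAt_apply i x
  simp [pd, h.fderiv, Pi.single_apply, Matrix.one_apply]

/-- The chain rule in coordinates. -/
lemma pd_comp {ψ : (Fin d → ℝ) → Fin d → ℝ} (hf : DifferentiableAt ℝ f (ψ x))
    (hψ : DifferentiableAt ℝ ψ x) (k : Fin d) :
    pd (fun z => f (ψ z)) k x = ∑ i, pd f i (ψ x) * pd (fun z => ψ z i) k x := by
  have h : fderiv ℝ (fun z => f (ψ z)) x = (fderiv ℝ f (ψ x)).comp (fderiv ℝ ψ x) :=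
    fderiv_comp x hf hψ
  simp only [pd, h, ContinuousLinearMap.comp_apply]
  have hc : ∀ i, fderiv ℝ (fun z => ψ z i) x (Pi.single k 1) =
      fderiv ℝ ψ x (Pi.single k 1) i := fun i => by
    have h' := (hasFDerivAt_pi'.1 hψ.hasFDerivAt i).fderiv
    rw [h']
    rfl
  simp only [hc]
  conv_lhs => rw [pi_eq_sum_univ' (fderiv ℝ ψ x (Pi.single k 1))]
  simp [mul_comm]

lemma ContDiffAt.pd {m n : WithTop ℕ∞} (hf : ContDiffAt ℝ n f x) (hmn : m + 1 ≤ n) (k : Fin d) :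
    ContDiffAt ℝ m (fun z => pd f k z) x :=
  (hf.fderiv_right hmn).clm_apply contDiffAt_const

lemma pd_pd_comm (hf : ContDiffAt ℝ 2 f x) (i j : Fin d) :
    pd (fun z => pd f i z) j x = pd (fun z => pd f j z) i x := by
  have hd : DifferentiableAt ℝ (fderiv ℝ f) x :=
    (hf.fderiv_right (m := 1) (by norm_num)).differentiableAt (by norm_num)
  have key : ∀ a b : Fin d, pd (fun z => pd f a z) b x =
      fderiv ℝ (fderiv ℝ f) x (Pi.single b 1) (Pi.single a 1) := fun a b => by
    have := hd.hasFDerivAt.clm_apply (hasFDerivAt_const (Pi.single a (1 : ℝ) : Fin d → ℝ) x)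
    simp only [_root_.pd, this.fderiv]
    simp
  rw [key, key]
  exact (hf.isSymmSndFDerivAt (by simp)).eq _ _

end PartialDerivatives

section Determinant

open Filter Topology Matrix

variable {d : ℕ} {n : Type*} [Fintype n] [DecidableEq n] {x : Fin d → ℝ}

lemma differentiableAt_det {A : (Fin d → ℝ) → Matrix n n ℝ}
    (hA : ∀ i j, DifferentiableAt ℝ (fun z => A z i j) x) :
    DifferentiableAt ℝ (fun z => (A z).det) x := by
  simp only [Matrix.det_apply']
  fun_prop

/-- Jacobi's formula. -/
lemma pd_det {A : (Fin d → ℝ) → Matrix n n ℝ}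
    (hA : ∀ i j, DifferentiableAt ℝ (fun z => A z i j) x) (k : Fin d) :
    pd (fun z => (A z).det) k x =
      ∑ i, ∑ j, (A x).adjugate i j * pd (fun z => A z j i) k x := by
  have hprod : ∀ σ : Equiv.Perm n, pd (fun z => ∏ i, A z (σ i) i) k x =
      ∑ i, (∏ j ∈ Finset.univ.erase i, A x (σ j) j) * pd (fun z => A z (σ i) i) k x := by
    intro σ
    have h := HasFDerivAt.finsetProd (u := Finset.univ) (x := x)
      (fun i _ => (hA (σ i) i).hasFDerivAt)
    simp [pd, h.fderiv]
  have hcol : ∀ i, ∑ j, (A x).adjugate i j * pd (fun z => A z j i) k x =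
      ((A x).updateCol i fun j => pd (fun z => A z j i) k x).det := by
    intro i
    rw [← Matrix.cramer_apply, Matrix.cramer_eq_adjugate_mulVec]
    rfl
  simp only [hcol]
  simp only [Matrix.det_apply']
  rw [pd_sum _ (fun σ _ => by fun_prop), Finset.sum_comm]
  refine Finset.sum_congr rfl fun σ _ => ?_
  rw [pd_mul (by fun_prop) (by fun_prop), pd_const, hprod, zero_mul, zero_add, Finset.mul_sum]
  refine Finset.sum_congr rfl fun i _ => ?_
  rw [← Finset.prod_erase_mul _ _ (Finset.mem_univ i), Matrix.updateCol_self]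
  congr 2
  exact Finset.prod_congr rfl fun j hj => by
    rw [Matrix.updateCol_ne (Finset.ne_of_mem_erase hj)]

lemma pd_abs {f : (Fin d → ℝ) → ℝ} (hf : DifferentiableAt ℝ f x) (h0 : f x ≠ 0) (k : Fin d) :
    pd (fun z => |f z|) k x = SignType.sign (f x) * pd f k x := by
  have h := (hasDerivAt_abs h0).comp_hasFDerivAt x hf.hasFDerivAt
  simp only [Function.comp_def] at h
  simp [pd, h.fderiv]

/-- The Piola identity: the cofactors of a curl-free matrix field `p` with inverse `q` are
divergence-free. -/
lemma sum_pd_abs_det_mul_inv_eq_zero {p q : (Fin d → ℝ) → Matrix (Fin d) (Fin d) ℝ}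
    (hp : ∀ i j, DifferentiableAt ℝ (fun z => p z i j) x)
    (hq : ∀ i j, DifferentiableAt ℝ (fun z => q z i j) x)
    (hpq : ∀ᶠ z in 𝓝 x, p z * q z = 1)
    (hcurl : ∀ i a b, pd (fun z => p z i a) b x = pd (fun z => p z i b) a x) (j : Fin d) :
    ∑ b, pd (fun z => |(p z).det| * q z b j) b x = 0 := by
  have hpq₀ : p x * q x = 1 := hpq.self_of_nhds
  have hqp₀ : q x * p x = 1 := mul_eq_one_comm.1 hpq₀
  have hdet : (p x).det ≠ 0 := (Matrix.isUnit_det_of_right_inverse hpq₀).ne_zero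
  have hadj : (p x).adjugate = (p x).det • q x := by
    calc (p x).adjugate = (p x).adjugate * (p x * q x) := by rw [hpq₀, mul_one]
      _ = (p x).det • q x := by rw [← mul_assoc, Matrix.adjugate_mul, smul_mul, one_mul]
  have hD := differentiableAt_det hp
  have hpdD : ∀ b, pd (fun z => |(p z).det|) b x =
      |(p x).det| * ∑ c, ∑ k, q x c k * pd (fun z => p z k c) b x := by
    intro b
    rw [pd_abs hD hdet, pd_det hp, hadj, ← sign_mul_self (p x).det]
    simp only [Matrix.smul_apply, smul_eq_mul, mul_assoc, Finset.mul_sum]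
  have hrel : ∀ k c, ∑ b, pd (fun z => p z k b) c x * q x b j =
      - ∑ b, p x k b * pd (fun z => q z b j) c x := by
    intro k c
    have h : (fun z => ∑ b, p z k b * q z b j) =ᶠ[𝓝 x]
        fun _ => (1 : Matrix (Fin d) (Fin d) ℝ) k j := by
      filter_upwards [hpq] with z hz
      rw [← hz, Matrix.mul_apply]
    have h' := pd_congr h c
    rw [pd_const, pd_sum _ (fun b _ => (hp k b).fun_mul (hq b j))] at h'
    simp only [pd_mul (hp _ _) (hq _ _), Finset.sum_add_distrib] at h'
    linarith
  have hone : ∀ c b, ∑ k, q x c k * p x k b = (1 : Matrix (Fin d) (Fin d) ℝ) c b := by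
    intro c b
    rw [← hqp₀, Matrix.mul_apply]
  have habs : DifferentiableAt ℝ (fun z => |(p z).det|) x := hD.abs hdet
  simp only [pd_mul habs (hq _ _), hpdD, Finset.sum_add_distrib]
  have hmain : ∑ b, (∑ c, ∑ k, q x c k * pd (fun z => p z k c) b x) * q x b j =
      - ∑ b, pd (fun z => q z b j) b x := by
    calc ∑ b, (∑ c, ∑ k, q x c k * pd (fun z => p z k c) b x) * q x b j
        = ∑ c, ∑ k, q x c k * ∑ b, pd (fun z => p z k b) c x * q x b j := by
          simp only [Finset.sum_mul, Finset.mul_sum]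
          rw [Finset.sum_comm]
          refine Finset.sum_congr rfl fun c _ => ?_
          rw [Finset.sum_comm]
          refine Finset.sum_congr rfl fun k _ => Finset.sum_congr rfl fun b _ => ?_
          rw [hcurl k c b, mul_assoc]
      _ = - ∑ c, ∑ b, (∑ k, q x c k * p x k b) * pd (fun z => q z b j) c x := by
          simp only [hrel, Finset.mul_sum, mul_neg, Finset.sum_neg_distrib, Finset.sum_mul]
          congr 1
          refine Finset.sum_congr rfl fun c _ => ?_
          rw [Finset.sum_comm]
          simp only [mul_assoc]
      _ = - ∑ b, pd (fun z => q z b j) b x := by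
          simp [hone, Matrix.one_apply]
  simp only [mul_assoc, ← Finset.mul_sum]
  rw [hmain]
  ring

end Determinant

section ChangeOfVariables

open Filter Topology Matrix

variable {d : ℕ} {φ ψ : (Fin d → ℝ) → Fin d → ℝ} {g L : (Fin d → ℝ) → Matrix (Fin d) (Fin d) ℝ}

/-- The Jacobian matrix `∂φ^a/∂x^i`. -/
noncomputable def jacobianMatrix (φ : (Fin d → ℝ) → Fin d → ℝ) (x : Fin d → ℝ) :
    Matrix (Fin d) (Fin d) ℝ :=
  Matrix.of fun a i => pd (fun z => φ z a) i x

lemma jacobianMatrix_apply (x : Fin d → ℝ) (a i : Fin d) :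
    jacobianMatrix φ x a i = pd (fun z => φ z a) i x := rfl

lemma jacobianMatrix_mul_of_leftInverse {x : Fin d → ℝ} (h : ∀ᶠ z in 𝓝 x, ψ (φ z) = z)
    (hφ : DifferentiableAt ℝ φ x) (hψ : DifferentiableAt ℝ ψ (φ x)) :
    jacobianMatrix ψ (φ x) * jacobianMatrix φ x = 1 := by
  ext i k
  have h' : (fun z => ψ (φ z) i) =ᶠ[𝓝 x] fun z => z i := by
    filter_upwards [h] with z hz
    rw [hz]
  rw [← pd_coord (x := x), ← pd_congr h' k,
    pd_comp (f := fun z => ψ z i) (differentiableAt_pi.1 hψ i) hφ, Matrix.mul_apply]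
  rfl

lemma metricP_eq (y : Fin d → ℝ) :
    metricP d ψ g y = (jacobianMatrix ψ y)ᵀ * g (ψ y) * jacobianMatrix ψ y := by
  ext a b
  simp only [metricP, Matrix.of_apply, Matrix.mul_apply, Matrix.transpose_apply,
    jacobianMatrix_apply, Finset.sum_mul]
  exact Finset.sum_comm

lemma tensorP_eq (y : Fin d → ℝ) :
    tensorP d φ ψ L y =
      jacobianMatrix φ (ψ y) * L (ψ y) * (jacobianMatrix φ (ψ y))ᵀ := by
  ext a b
  simp only [tensorP, Matrix.of_apply, Matrix.mul_apply, Matrix.transpose_apply,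
    jacobianMatrix_apply, Finset.sum_mul]
  exact Finset.sum_comm

lemma symPart_eq (x : Fin d → ℝ) : symPart d L x = (2⁻¹ : ℝ) • (L x + (L x)ᵀ) := by
  ext i j
  simp only [symPart, Matrix.of_apply, Matrix.smul_apply, Matrix.add_apply,
    Matrix.transpose_apply, smul_eq_mul]
  ring

lemma symPart_tensorP (y : Fin d → ℝ) :
    symPart d (tensorP d φ ψ L) y =
      jacobianMatrix φ (ψ y) * symPart d L (ψ y) * (jacobianMatrix φ (ψ y))ᵀ := by
  simp only [symPart_eq, tensorP_eq, Matrix.transpose_mul, Matrix.transpose_transpose,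
    Matrix.mul_smul, Matrix.smul_mul, Matrix.mul_add, Matrix.add_mul, Matrix.mul_assoc]

lemma sum_symPart_mul {x : Fin d → ℝ} {H : Fin d → Fin d → ℝ} (hH : ∀ i j, H i j = H j i) :
    ∑ i, ∑ j, symPart d L x i j * H i j = ∑ i, ∑ j, L x i j * H i j := by
  have h : ∑ i, ∑ j, L x j i * H i j = ∑ i, ∑ j, L x i j * H i j := by
    rw [Finset.sum_comm]
    simp only [hH]
  calc ∑ i, ∑ j, symPart d L x i j * H i j
      = (∑ i, ∑ j, L x i j * H i j + ∑ i, ∑ j, L x j i * H i j) / 2 := by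
        simp only [← Finset.sum_add_distrib, Finset.sum_div]
        refine Finset.sum_congr rfl fun i _ => Finset.sum_congr rfl fun j _ => ?_
        simp only [symPart, Matrix.of_apply]
        ring
    _ = ∑ i, ∑ j, L x i j * H i j := by rw [h]; ring

lemma sqrt_det_metricP (y : Fin d → ℝ) :
    Real.sqrt (metricP d ψ g y).det =
      |(jacobianMatrix ψ y).det| * Real.sqrt (g (ψ y)).det := by
  rw [metricP_eq, Matrix.det_mul, Matrix.det_mul, Matrix.det_transpose,
    show ∀ D G : ℝ, D * G * D = D ^ 2 * G from fun D G => by ring,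
    Real.sqrt_mul (sq_nonneg _), Real.sqrt_sq_eq_abs]

lemma dotProduct_conj_inv_mulVec {n : Type*} [Fintype n] [DecidableEq n]
    {J : Matrix n n ℝ} (hJ : IsUnit J.det) (B : Matrix n n ℝ) (v : n → ℝ) :
    (J *ᵥ v) ⬝ᵥ ((J * B * Jᵀ)⁻¹ *ᵥ (J *ᵥ v)) = v ⬝ᵥ (B⁻¹ *ᵥ v) := by
  have hJt : IsUnit Jᵀ.det := by rwa [Matrix.det_transpose]
  have h : Jᵀ * (J * B * Jᵀ)⁻¹ * J = B⁻¹ := by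
    rw [Matrix.mul_inv_rev, Matrix.mul_inv_rev, ← Matrix.mul_assoc, Matrix.mul_nonsing_inv _ hJt,
      Matrix.one_mul, Matrix.mul_assoc, Matrix.nonsing_inv_mul _ hJ, Matrix.mul_one]
  rw [← h, ← Matrix.mulVec_mulVec, ← Matrix.mulVec_mulVec, Matrix.dotProduct_mulVec v,
    Matrix.vecMul_transpose]

lemma sum_sum_mul_mul_eq_dotProduct {n : Type*} [Fintype n] (A : Matrix n n ℝ) (v : n → ℝ) :
    ∑ i, ∑ j, v i * A i j * v j = v ⬝ᵥ (A *ᵥ v) := by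
  simp only [dotProduct, Matrix.mulVec, Finset.mul_sum, mul_assoc]

/-- The drift is a contravariant vector up to the Ito correction `L^{ij} ∂_i ∂_j φ^a`. -/
lemma classDrift_metricP_tensorP {Upot : (Fin d → ℝ) → ℝ} {y : Fin d → ℝ}
    (hφψ : ∀ᶠ z in 𝓝 y, φ (ψ z) = z)
    (hφ : ContDiffAt ℝ 2 φ (ψ y)) (hψ : ContDiffAt ℝ 2 ψ y)
    (hpos : 0 < (g (ψ y)).det)
    (hg : ∀ i j, DifferentiableAt ℝ (fun z => g z i j) (ψ y))
    (hL : ∀ i j, DifferentiableAt ℝ (fun z => L z i j) (ψ y))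
    (hUpot : DifferentiableAt ℝ Upot (ψ y)) (a : Fin d) :
    classDrift d (metricP d ψ g) (tensorP d φ ψ L) (fun z => Upot (ψ z)) y a =
      ∑ i, pd (fun z => φ z a) i (ψ y) * classDrift d g L Upot (ψ y) i +
        ∑ i, ∑ j, L (ψ y) i j * pd2 (fun z => φ z a) i j (ψ y) := by
  have hψd : DifferentiableAt ℝ ψ y := hψ.differentiableAt (by norm_num)
  have hφi : ∀ b, ContDiffAt ℝ 2 (fun z => φ z b) (ψ y) := contDiffAt_pi.1 hφ
  have hψi : ∀ i, ContDiffAt ℝ 2 (fun z => ψ z i) y := contDiffAt_pi.1 hψ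
  have hJ : ∀ b i, DifferentiableAt ℝ (fun z => jacobianMatrix φ z b i) (ψ y) := fun b i =>
    ((hφi b).pd (m := 1) (by norm_num) i).differentiableAt (by norm_num)
  have hp : ∀ i b, DifferentiableAt ℝ (fun z => jacobianMatrix ψ z i b) y := fun i b =>
    ((hψi i).pd (m := 1) (by norm_num) b).differentiableAt (by norm_num)
  have hq : ∀ b i, DifferentiableAt ℝ (fun z => jacobianMatrix φ (ψ z) b i) y := fun b i =>
    (hJ b i).comp y hψd
  have hpq : ∀ᶠ z in 𝓝 y, jacobianMatrix ψ z * jacobianMatrix φ (ψ z) = 1 := by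
    filter_upwards [hφψ.eventually_nhds, hψ.eventually (by simp),
      hψ.continuousAt.eventually (hφ.eventually (by simp))] with z hz hψz hφz
    exact mul_eq_one_comm.1 (jacobianMatrix_mul_of_leftInverse hz
      (hψz.differentiableAt (by norm_num)) (hφz.differentiableAt (by norm_num)))
  have hpq₀ := hpq.self_of_nhds
  have hD : (jacobianMatrix ψ y).det ≠ 0 := (Matrix.isUnit_det_of_right_inverse hpq₀).ne_zero
  have habs : DifferentiableAt ℝ (fun z => |(jacobianMatrix ψ z).det|) y :=
    (differentiableAt_det hp).abs hD
  have hs : DifferentiableAt ℝ (fun z => Real.sqrt (g z).det) (ψ y) :=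
    (differentiableAt_det hg).sqrt hpos.ne'
  have hs₀ : Real.sqrt (g (ψ y)).det ≠ 0 := (Real.sqrt_pos.2 hpos).ne'
  have hpiola := sum_pd_abs_det_mul_inv_eq_zero hp hq hpq
    (fun i b c => pd_pd_comm (hψi i) b c)
  have hcontract : ∀ (w : Fin d → ℝ) (j : Fin d),
      ∑ b, jacobianMatrix φ (ψ y) b j * ∑ k, w k * pd (fun z => ψ z k) b y = w j := by
    intro w j
    have h : ∀ k, ∑ b, pd (fun z => ψ z k) b y * jacobianMatrix φ (ψ y) b j =
        (1 : Matrix (Fin d) (Fin d) ℝ) k j := fun k => by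
      rw [← hpq₀, Matrix.mul_apply]
      rfl
    calc ∑ b, jacobianMatrix φ (ψ y) b j * ∑ k, w k * pd (fun z => ψ z k) b y
        = ∑ k, w k * ∑ b, pd (fun z => ψ z k) b y * jacobianMatrix φ (ψ y) b j := by
          simp only [Finset.mul_sum]
          rw [Finset.sum_comm]
          refine Finset.sum_congr rfl fun k _ => Finset.sum_congr rfl fun b _ => ?_
          ring
      _ = w j := by simp [h, Matrix.one_apply]
  set M : Fin d → (Fin d → ℝ) → ℝ := fun j z =>
    ∑ i, jacobianMatrix φ z a i * (Real.sqrt (g z).det * L z i j) with hM_def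
  have hsL : ∀ i j, DifferentiableAt ℝ (fun z => Real.sqrt (g z).det * L z i j) (ψ y) :=
    fun i j => hs.fun_mul (hL i j)
  have hM : ∀ j, DifferentiableAt ℝ (M j) (ψ y) := fun j =>
    DifferentiableAt.fun_sum fun i _ => (hJ a i).fun_mul (hsL i j)
  have hMψ : ∀ j, DifferentiableAt ℝ (fun z => M j (ψ z)) y := fun j => (hM j).comp y hψd
  have hflux : ∀ z b, Real.sqrt (metricP d ψ g z).det * tensorP d φ ψ L z a b =
      ∑ j, (|(jacobianMatrix ψ z).det| * jacobianMatrix φ (ψ z) b j) * M j (ψ z) := by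
    intro z b
    rw [sqrt_det_metricP, tensorP_eq, Matrix.mul_apply, Finset.mul_sum]
    refine Finset.sum_congr rfl fun j _ => ?_
    simp only [hM_def, Matrix.mul_apply, Matrix.transpose_apply, Finset.sum_mul, Finset.mul_sum]
    refine Finset.sum_congr rfl fun i _ => ?_
    ring
  have hdiv : ∑ b, pd (fun z => Real.sqrt (metricP d ψ g z).det * tensorP d φ ψ L z a b) b y =
      |(jacobianMatrix ψ y).det| * ∑ j, pd (M j) j (ψ y) := by
    have hterm : ∀ b,
        pd (fun z => Real.sqrt (metricP d ψ g z).det * tensorP d φ ψ L z a b) b y =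
        ∑ j, (pd (fun z => |(jacobianMatrix ψ z).det| * jacobianMatrix φ (ψ z) b j) b y *
            M j (ψ y) +
          |(jacobianMatrix ψ y).det| * (jacobianMatrix φ (ψ y) b j *
            ∑ k, pd (M j) k (ψ y) * pd (fun z => ψ z k) b y)) := by
      intro b
      simp only [hflux]
      rw [pd_sum _ fun j _ => (habs.fun_mul (hq b j)).fun_mul (hMψ j)]
      refine Finset.sum_congr rfl fun j _ => ?_
      rw [pd_mul (habs.fun_mul (hq b j)) (hMψ j), pd_comp (hM j) hψd, mul_assoc]
    simp only [hterm]
    rw [Finset.sum_comm]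
    simp only [Finset.sum_add_distrib, ← Finset.sum_mul, ← Finset.mul_sum, hpiola, hcontract]
    simp
  have hdivM : ∑ j, pd (M j) j (ψ y) =
      Real.sqrt (g (ψ y)).det * ∑ i, ∑ j, L (ψ y) i j * pd2 (fun z => φ z a) i j (ψ y) +
      ∑ i, jacobianMatrix φ (ψ y) a i *
        ∑ j, pd (fun z => Real.sqrt (g z).det * L z i j) j (ψ y) := by
    have hterm : ∀ j, pd (M j) j (ψ y) =
        ∑ i, (Real.sqrt (g (ψ y)).det * (L (ψ y) i j * pd2 (fun z => φ z a) i j (ψ y)) +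
          jacobianMatrix φ (ψ y) a i *
            pd (fun z => Real.sqrt (g z).det * L z i j) j (ψ y)) := by
      intro j
      rw [hM_def, pd_sum _ fun i _ => (hJ a i).fun_mul (hsL i j)]
      refine Finset.sum_congr rfl fun i _ => ?_
      rw [pd_mul (hJ a i) (hsL i j)]
      have hsymm : pd (fun z => jacobianMatrix φ z a i) j (ψ y) =
          pd2 (fun z => φ z a) i j (ψ y) := pd_pd_comm (hφi a) i j
      rw [hsymm]
      ring
    simp only [hterm]
    rw [Finset.sum_comm]
    simp only [Finset.sum_add_distrib, ← Finset.mul_sum]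
  have hpot : ∑ b, tensorP d φ ψ L y a b * pd (fun z => Upot (ψ z)) b y =
      ∑ i, jacobianMatrix φ (ψ y) a i * ∑ j, L (ψ y) i j * pd Upot j (ψ y) := by
    calc ∑ b, tensorP d φ ψ L y a b * pd (fun z => Upot (ψ z)) b y
        = ∑ j, (jacobianMatrix φ (ψ y) * L (ψ y)) a j * ∑ b, jacobianMatrix φ (ψ y) b j *
            ∑ k, pd Upot k (ψ y) * pd (fun z => ψ z k) b y := by
          simp only [pd_comp hUpot hψd, tensorP_eq]
          simp only [Matrix.mul_apply (M := jacobianMatrix φ (ψ y) * L (ψ y)),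
            Matrix.transpose_apply, Finset.sum_mul]
          rw [Finset.sum_comm]
          simp only [mul_assoc, Finset.mul_sum]
      _ = ∑ i, jacobianMatrix φ (ψ y) a i * ∑ j, L (ψ y) i j * pd Upot j (ψ y) := by
          simp only [hcontract]
          simp only [Matrix.mul_apply, Finset.sum_mul, Finset.mul_sum, mul_assoc]
          exact Finset.sum_comm
  simp only [classDrift, ← jacobianMatrix_apply]
  rw [hdiv, hpot, hdivM, sqrt_det_metricP]
  simp only [mul_sub, Finset.sum_sub_distrib]
  have hscale : ∑ i, jacobianMatrix φ (ψ y) a i * ((Real.sqrt (g (ψ y)).det)⁻¹ *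
        ∑ j, pd (fun z => Real.sqrt (g z).det * L z i j) j (ψ y)) =
      (Real.sqrt (g (ψ y)).det)⁻¹ * ∑ i, jacobianMatrix φ (ψ y) a i *
        ∑ j, pd (fun z => Real.sqrt (g z).det * L z i j) j (ψ y) := by
    rw [Finset.mul_sum]
    exact Finset.sum_congr rfl fun i _ => mul_left_comm _ _ _
  rw [hscale]
  have hDabs := abs_ne_zero.2 hD
  field_simp
  ring

end ChangeOfVariables

/-- covariance of the classical α = 0 time-slice action under Ito's
formula: with `Δy^a = (∂φ^a/∂x^i) Δx^i + B^{ij} (∂²φ^a/∂x^i∂x^j) Δt` (all at `x₀`),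
(a) `Δy^a − F'^a Δt = (∂φ^a/∂x^i)(Δx^i − F^i Δt)`, and
(b) `(Δy − F'Δt)ᵀ B'⁻¹ (Δy − F'Δt) = (Δx − FΔt)ᵀ B⁻¹ (Δx − FΔt)`, so the α = 0
time-slice action `(Δx − FΔt)ᵀ B⁻¹ (Δx − FΔt)/(4Δt)` is invariant. -/
theorem classical_action_covariance (d : ℕ) (hd : 1 ≤ d)
    (U V : Set (Fin d → ℝ)) (hU : IsOpen U) (hV : IsOpen V)
    (φ ψ : (Fin d → ℝ) → (Fin d → ℝ))
    (hφV : Set.MapsTo φ U V) (hψU : Set.MapsTo ψ V U)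
    (hψφ : ∀ x ∈ U, ψ (φ x) = x) (hφψ : ∀ y ∈ V, φ (ψ y) = y)
    (hφ : ContDiffOn ℝ 3 φ U) (hψ : ContDiffOn ℝ 3 ψ V)
    (g : (Fin d → ℝ) → Matrix (Fin d) (Fin d) ℝ)
    (hgsymm : ∀ x ∈ U, (g x).IsSymm) (hgpos : ∀ x ∈ U, (g x).PosDef)
    (hgC1 : ∀ i j, ContDiffOn ℝ 1 (fun x => g x i j) U)
    (L : (Fin d → ℝ) → Matrix (Fin d) (Fin d) ℝ)
    (hLC1 : ∀ i j, ContDiffOn ℝ 1 (fun x => L x i j) U)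
    (hBpos : ∀ x ∈ U, (symPart d L x).PosDef)
    (Upot : (Fin d → ℝ) → ℝ) (hUpot : ContDiffOn ℝ 1 Upot U)
    (x₀ : Fin d → ℝ) (hx₀ : x₀ ∈ U) (Δt : ℝ) (hΔt : 0 < Δt)
    (Δx : Fin d → ℝ) (Δy : Fin d → ℝ)
    (hΔy : ∀ a, Δy a =
      (∑ i, pd (fun z => φ z a) i x₀ * Δx i) +
      (∑ i, ∑ j, symPart d L x₀ i j * pd2 (fun z => φ z a) i j x₀) * Δt) :
    (∀ a, Δy a -
        classDrift d (metricP d ψ g) (tensorP d φ ψ L) (fun y => Upot (ψ y)) (φ x₀) a * Δt =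
      ∑ i, pd (fun z => φ z a) i x₀ * (Δx i - classDrift d g L Upot x₀ i * Δt)) ∧
    (∑ a, ∑ b,
        (Δy a - classDrift d (metricP d ψ g) (tensorP d φ ψ L) (fun y => Upot (ψ y)) (φ x₀) a * Δt) *
          (symPart d (tensorP d φ ψ L) (φ x₀))⁻¹ a b *
        (Δy b - classDrift d (metricP d ψ g) (tensorP d φ ψ L) (fun y => Upot (ψ y)) (φ x₀) b * Δt) =
      ∑ i, ∑ j,
        (Δx i - classDrift d g L Upot x₀ i * Δt) * (symPart d L x₀)⁻¹ i j *
        (Δx j - classDrift d g L Upot x₀ j * Δt)) := by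
  have hUx := hU.mem_nhds hx₀
  have hVy := hV.mem_nhds (hφV hx₀)
  have hinv : ψ (φ x₀) = x₀ := hψφ x₀ hx₀
  have hφ₀ : ContDiffAt ℝ 2 φ x₀ := (hφ.contDiffAt hUx).of_le (by norm_num)
  have hψ₀ : ContDiffAt ℝ 2 ψ (φ x₀) := (hψ.contDiffAt hVy).of_le (by norm_num)
  have hdrift := fun a => classDrift_metricP_tensorP (g := g) (L := L) (Upot := Upot)
    (Filter.eventually_of_mem hVy hφψ) (by rwa [hinv]) hψ₀
    (by rw [hinv]; exact (hgpos x₀ hx₀).det_pos)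
    (fun i j => by rw [hinv]; exact ((hgC1 i j).contDiffAt hUx).differentiableAt (by norm_num))
    (fun i j => by rw [hinv]; exact ((hLC1 i j).contDiffAt hUx).differentiableAt (by norm_num))
    (by rw [hinv]; exact (hUpot.contDiffAt hUx).differentiableAt (by norm_num)) a
  rw [hinv] at hdrift
  have hvec : ∀ a, Δy a -
        classDrift d (metricP d ψ g) (tensorP d φ ψ L) (fun y => Upot (ψ y)) (φ x₀) a * Δt =
      ∑ i, pd (fun z => φ z a) i x₀ * (Δx i - classDrift d g L Upot x₀ i * Δt) := by
    intro a
    have hcomm : ∀ i j, pd2 (fun z => φ z a) i j x₀ = pd2 (fun z => φ z a) j i x₀ :=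
      fun i j => pd_pd_comm (contDiffAt_pi.1 hφ₀ a) j i
    rw [hΔy, hdrift, sum_symPart_mul hcomm]
    simp only [mul_sub, Finset.sum_sub_distrib, ← mul_assoc, ← Finset.sum_mul]
    ring
  refine ⟨hvec, ?_⟩
  have hJ : IsUnit (jacobianMatrix φ x₀).det :=
    Matrix.isUnit_det_of_left_inverse (jacobianMatrix_mul_of_leftInverse
      (Filter.eventually_of_mem hUx hψφ) (hφ₀.differentiableAt (by norm_num))
      (hψ₀.differentiableAt (by norm_num)))
  have hquad := dotProduct_conj_inv_mulVec hJ (symPart d L x₀)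
    (fun i => Δx i - classDrift d g L Upot x₀ i * Δt)
  have hsym := symPart_tensorP (φ := φ) (ψ := ψ) (L := L) (φ x₀)
  rw [hinv] at hsym
  rw [← hsym, ← sum_sum_mul_mul_eq_dotProduct, ← sum_sum_mul_mul_eq_dotProduct] at hquad
  simp only [hvec]
  exact hquad
end
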